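/- arXiv:1402.4184 — 2 statements merged into one kernel-verified Lean document; each statement's English description precedes it below -/
import Mathlib

section
/- Let G be a countably infinite discrete group and let G ↷ (X, μ) be a free measure-preserving Borel action of G on a standard Borel probability space. Then for every ε > 0 there exist a standard Borel space Z with a free Borel action G ↷ Z, a G-invariant Borel probability measure η on Z, and a factor map f : (X, μ) → (Z, η), such that G ↷ Z admits a 2-piece generating partition {C₀, C₁} with Shannon entropy H_η({C₀, C₁}) < ε. -/
open MeasureTheory Set
open Filter Topology
open scoped ENNReal symmDiff

namespace MeasureTheory

instance MeasuredSets.instCompleteSpace {α : Type*} [MeasurableSpace α] {μ : Measure α} :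
    CompleteSpace (MeasuredSets μ) := by
  refine EMetric.complete_of_convergent_controlled_sequences (fun n ↦ (2⁻¹ : ℝ≥0∞) ^ n)
    (fun n ↦ ENNReal.pow_pos (by simp) n) fun u hu ↦ ?_
  have hA : MeasurableSet {x | ∃ N, ∀ n, N ≤ n → x ∈ (u n : Set α)} := by
    simp only [ofPred_exists, ofPred_forall]
    exact .iUnion fun N ↦ .iInter fun n ↦ .iInter fun _ ↦ (u n).2
  refine ⟨⟨_, hA⟩, tendsto_iff_edist_tendsto_0.2 ?_⟩
  have hsub (n : ℕ) : (u n : Set α) ∆ {x | ∃ N, ∀ n, N ≤ n → x ∈ (u n : Set α)} ⊆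
      ⋃ k, (u (n + k) : Set α) ∆ (u (n + k + 1)) := by
    intro x hx
    by_contra hcon
    have hstep (k : ℕ) : x ∈ (u (n + k) : Set α) ↔ x ∈ (u n : Set α) := by
      induction k with
      | zero => rfl
      | succ k ih =>
        rw [← ih]
        by_contra h
        refine hcon (mem_iUnion.2 ⟨k, ?_⟩)
        rw [mem_symmDiff]
        rw [← add_assoc] at h
        tauto
    have hiff : (∃ N, ∀ m, N ≤ m → x ∈ (u m : Set α)) ↔ x ∈ (u n : Set α) := by
      constructor
      · rintro ⟨N, hN⟩
        exact (hstep N).1 (hN _ (by omega))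
      · intro h
        refine ⟨n, fun m hm ↦ ?_⟩
        obtain ⟨k, rfl⟩ := Nat.exists_eq_add_of_le hm
        exact (hstep k).2 h
    rw [mem_symmDiff, mem_ofPred_eq, hiff] at hx
    tauto
  have hbound (n : ℕ) : edist (u n) (⟨_, hA⟩ : MeasuredSets μ) ≤ 2⁻¹ ^ n * 2 := by
    calc μ ((u n : Set α) ∆ {x | ∃ N, ∀ n, N ≤ n → x ∈ (u n : Set α)})
        ≤ ∑' k, μ ((u (n + k) : Set α) ∆ (u (n + k + 1))) :=
          (measure_mono (hsub n)).trans (measure_iUnion_le _)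
      _ ≤ ∑' k, 2⁻¹ ^ n * 2⁻¹ ^ k := by
          refine ENNReal.tsum_le_tsum fun k ↦ ?_
          rw [← pow_add]
          exact (hu (n + k) (n + k) (n + k + 1) le_rfl (by omega)).le
      _ = 2⁻¹ ^ n * 2 := by
          rw [ENNReal.tsum_mul_left, ENNReal.tsum_geometric, ENNReal.one_sub_inv_two, inv_inv]
  refine tendsto_of_tendsto_of_tendsto_of_le_of_le tendsto_const_nhds ?_ (fun _ ↦ zero_le)
    hbound
  have := ENNReal.Tendsto.mul_const (b := 2)
    (ENNReal.tendsto_pow_atTop_nhds_zero_of_lt_one (r := 2⁻¹) (by simp)) (by simp)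
  simpa using this

/-- The points `x` such that `A` does not separate the `G`-orbit labellings of `x` and `g • x`. -/
def unseparated {G X : Type*} [SMul G X] (A : Set X) (g : G) : Set X :=
  {x | ∀ h : G, h • x ∈ A ↔ h • g • x ∈ A}

section Action

variable {G X : Type*} [Group G] [MeasurableSpace X] [MulAction G X] [MeasurableConstSMul G X]

lemma measurableSet_setOf_smul_mem_iff {A : Set X} (hA : MeasurableSet A) (g h : G) :
    MeasurableSet {x : X | h • x ∈ A ↔ h • g • x ∈ A} :=
  .iff (measurable_const_smul h hA) (((measurable_const_smul h).comp (measurable_const_smul g)) hA)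

lemma measurableSet_unseparated [Countable G] {A : Set X} (hA : MeasurableSet A) (g : G) :
    MeasurableSet (unseparated A g) := by
  simp only [unseparated, ofPred_forall]
  exact .iInter fun h ↦ measurableSet_setOf_smul_mem_iff hA g h

variable {μ : Measure X} [IsProbabilityMeasure μ]

/-- Changing `A` on a small set keeps most separated points separated. -/
lemma exists_pos_measure_unseparated_symmDiff_diff_lt [SMulInvariantMeasure G X μ]
    [Countable G] {A : Set X} (hA : MeasurableSet A) (g : G) {ε : ℝ≥0∞}
    (hε : 0 < ε) :
    ∃ ρ : ℝ≥0∞, 0 < ρ ∧ ∀ D : Set X, μ D < ρ →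
      μ (unseparated (A ∆ D) g \ unseparated A g) < ε := by
  classical
  obtain ⟨F, hF⟩ : ∃ F : Finset G,
      μ ({x | ∀ h ∈ F, (h • x ∈ A ↔ h • g • x ∈ A)} \ unseparated A g) < ε / 2 := by
    have hlim := tendsto_measure_iInter_atTop (μ := μ)
      (s := fun F : Finset G ↦ {x | ∀ h ∈ F, (h • x ∈ A ↔ h • g • x ∈ A)} \ unseparated A g)
      (fun F ↦ (MeasurableSet.diff (by
        simp only [ofPred_forall]
        exact F.measurableSet_biInter fun h _ ↦ measurableSet_setOf_smul_mem_iff hA g h)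
        (measurableSet_unseparated hA g)).nullMeasurableSet)
      (fun F F' h x hx ↦ ⟨fun k hk ↦ hx.1 k (h hk), hx.2⟩) ⟨∅, measure_ne_top _ _⟩
    have hempty : ⋂ F : Finset G,
        {x | ∀ h ∈ F, (h • x ∈ A ↔ h • g • x ∈ A)} \ unseparated A g = ∅ := by
      refine eq_empty_of_forall_notMem fun x hx ↦ ?_
      rw [mem_iInter] at hx
      exact (hx ∅).2 fun h ↦ (hx {h}).1 h (by simp)
    rw [hempty, measure_empty] at hlim
    exact (hlim.eventually_lt_const (ENNReal.half_pos hε.ne')).exists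
  set T : Finset G := F ∪ F.image (· * g) with hT
  refine ⟨ε / 2 / (T.card + 1), ENNReal.div_pos (ENNReal.half_pos hε.ne').ne' (by finiteness),
    fun D hD ↦ ?_⟩
  have hsub : unseparated (A ∆ D) g \ unseparated A g ⊆
      ({x | ∀ h ∈ F, (h • x ∈ A ↔ h • g • x ∈ A)} \ unseparated A g) ∪
        ⋃ h ∈ T, (fun x ↦ h • x) ⁻¹' D := by
    rintro x ⟨hx, hxA⟩
    by_contra hcon
    rw [mem_union, not_or] at hcon
    obtain ⟨h1, h2⟩ := hcon
    refine h1 ⟨fun h hh ↦ ?_, hxA⟩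
    have hD1 : h • x ∉ D := fun hd ↦ h2 <| mem_iUnion₂.2
      ⟨h, by simp [hT, hh], hd⟩
    have hD2 : h • g • x ∉ D := fun hd ↦ h2 <| mem_iUnion₂.2
      ⟨h * g, by simp [hT, hh], by simpa [mul_smul] using hd⟩
    have := hx h
    simp only [mem_symmDiff] at this
    tauto
  have hTD : μ (⋃ h ∈ T, (fun x ↦ h • x) ⁻¹' D) ≤ ε / 2 := by
    calc μ (⋃ h ∈ T, (fun x ↦ h • x) ⁻¹' D) ≤ ∑ h ∈ T, μ ((fun x ↦ h • x) ⁻¹' D) :=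
          measure_biUnion_finset_le _ _
      _ = T.card * μ D := by simp [measure_preimage_smul]
      _ ≤ (T.card + 1) * (ε / 2 / (T.card + 1)) := by gcongr; simp
      _ = ε / 2 := ENNReal.mul_div_cancel (by simp) (by finiteness)
  calc μ (unseparated (A ∆ D) g \ unseparated A g)
      ≤ _ := (measure_mono hsub).trans (measure_union_le _ _)
    _ < ε / 2 + ε / 2 := ENNReal.add_lt_add_of_lt_of_le
        (measure_ne_top _ _) hF hTD
    _ = ε := ENNReal.add_halves ε

/-- Finitely many coordinates of a measurable injection into Cantor space separate a given finite
set of translates of most points. -/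
lemma exists_measure_not_injOn_smul_lt (hfree : ∀ (g : G) (x : X), g • x = x → g = 1)
    {c : X → ℕ → Bool} (hc : Measurable c) (hinj : Function.Injective c) (T : Finset G)
    {ε : ℝ≥0∞} (hε : 0 < ε) :
    ∃ M : ℕ, μ {x | ¬ InjOn (fun (u : G) (i : Fin M) ↦ c (u • x) i) T} < ε := by
  classical
  have hpair : ∀ p ∈ T.offDiag, Tendsto (fun M : ℕ ↦
      μ {x | ∀ i < M, c (p.1 • x) i = c (p.2 • x) i}) atTop (𝓝 0) := by
    intro p hp
    have hlim := tendsto_measure_iInter_atTop (μ := μ)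
      (s := fun M : ℕ ↦ {x | ∀ i < M, c (p.1 • x) i = c (p.2 • x) i})
      (fun M ↦ (by
        simp only [ofPred_forall]
        refine .iInter fun i ↦ .iInter fun _ ↦ measurableSet_eq_fun ?_ ?_
        · exact (measurable_pi_apply i).comp (hc.comp (measurable_const_smul p.1))
        · exact (measurable_pi_apply i).comp (hc.comp (measurable_const_smul p.2)) :
          MeasurableSet _).nullMeasurableSet)
      (fun M M' h x hx i hi ↦ hx i (hi.trans_le h)) ⟨0, measure_ne_top _ _⟩
    have hempty : ⋂ M : ℕ, {x | ∀ i < M, c (p.1 • x) i = c (p.2 • x) i} = ∅ := by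
      refine eq_empty_of_forall_notMem fun x hx ↦ ?_
      rw [mem_iInter] at hx
      have heq : p.1 • x = p.2 • x := hinj (funext fun i ↦ hx (i + 1) i (by omega))
      have := hfree (p.2⁻¹ * p.1) x (by rw [mul_smul, heq, inv_smul_smul])
      exact (Finset.mem_offDiag.1 hp).2.2 (inv_mul_eq_one.1 this).symm
    rwa [hempty, measure_empty] at hlim
  have hsum := tendsto_finsetSum T.offDiag hpair
  rw [Finset.sum_const_zero] at hsum
  obtain ⟨M, hM⟩ := (hsum.eventually_lt_const hε).exists
  refine ⟨M, lt_of_le_of_lt ?_ hM⟩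
  refine (measure_mono fun x hx ↦ ?_).trans (measure_biUnion_finset_le T.offDiag _)
  simp only [mem_ofPred_eq, InjOn, not_forall] at hx
  obtain ⟨u, hu, v, hv, huv, hne⟩ := hx
  exact mem_iUnion₂.2 ⟨(u, v), Finset.mem_offDiag.2 ⟨hu, hv, hne⟩,
    fun i hi ↦ congrFun huv ⟨i, hi⟩⟩

end Action

/-- The Bernoulli measure on `Bool` giving mass `p` to `true`. -/
noncomputable def boolMeasure (p : ℝ) : Measure Bool :=
  ENNReal.ofReal p • Measure.dirac true + ENNReal.ofReal (1 - p) • Measure.dirac false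

lemma boolMeasure_true (p : ℝ) : boolMeasure p {true} = ENNReal.ofReal p := by
  simp [boolMeasure]

lemma boolMeasure_false (p : ℝ) : boolMeasure p {false} = ENNReal.ofReal (1 - p) := by
  simp [boolMeasure]

lemma isProbabilityMeasure_boolMeasure {p : ℝ} (h0 : 0 ≤ p) (h1 : p ≤ 1) :
    IsProbabilityMeasure (boolMeasure p) := by
  refine ⟨?_⟩
  simp [boolMeasure, ← ENNReal.ofReal_add h0 (sub_nonneg.2 h1)]

lemma pi_setOf_forall_mem_finset {K Y : Type*} [Fintype K] [MeasurableSpace Y]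
    (ν : Measure Y) [IsProbabilityMeasure ν] (t : Finset K) (s : Set Y) :
    Measure.pi (fun _ : K ↦ ν) {ω | ∀ k ∈ t, ω k ∈ s} = ν s ^ t.card := by
  classical
  have : {ω : K → Y | ∀ k ∈ t, ω k ∈ s} = univ.pi fun k ↦ if k ∈ t then s else univ := by
    ext ω
    simp only [mem_ofPred_eq, Set.mem_pi, mem_univ, true_imp_iff]
    refine forall_congr' fun k ↦ ?_
    split_ifs with h <;> simp [h]
  rw [this, Measure.pi_pi]
  simp only [apply_ite ν, measure_univ]
  rw [Finset.prod_ite_mem, Finset.univ_inter, Finset.prod_const]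

lemma exists_sparse_parameters {ε : ℝ} (hε : 0 < ε) :
    ∃ (p : ℝ) (m : ℕ), 0 ≤ p ∧ p ≤ 1 ∧ p + (1 - p) ^ m + m * p ^ 2 < ε := by
  obtain ⟨L, hL⟩ : ∃ L : ℕ, Real.exp (-1) ^ L < ε / 3 :=
    exists_pow_lt_of_lt_one (by positivity) (by simp)
  obtain ⟨n, hn⟩ := exists_nat_gt (max 1 (3 * (L + 1) / ε))
  have hn1 : (1 : ℝ) < n := (le_max_left _ _).trans_lt hn
  have hn0 : (0 : ℝ) < n := by linarith
  have hn2 : (L + 1) / (n : ℝ) < ε / 3 := by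
    have := (le_max_right _ _).trans_lt hn
    rw [div_lt_iff₀ hε] at this
    rw [div_lt_iff₀ hn0]
    linarith
  refine ⟨1 / n, n * L, by positivity, by rw [div_le_one hn0]; exact hn1.le, ?_⟩
  have h1 : (1 - 1 / (n : ℝ)) ^ (n * L) ≤ Real.exp (-1) ^ L := by
    rw [pow_mul]
    have : 1 / (n : ℝ) ≤ 1 := by rw [div_le_one hn0]; exact hn1.le
    gcongr
    exact Real.one_sub_div_pow_le_exp_neg hn1.le
  have h2 : 1 / (n : ℝ) + (n * L : ℕ) * (1 / (n : ℝ)) ^ 2 = (L + 1) / n := by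
    push_cast
    field_simp
    ring
  linarith

section Action

variable {G X : Type*} [Group G] [MeasurableSpace X] [MulAction G X] [MeasurableConstSMul G X]
  {μ : Measure X} [IsProbabilityMeasure μ]

/-- There are sets of small measure separating most points `x` from their translates `g • x`.
One such set is the preimage of a random sparse subset of a fine finite quotient of `X`. -/
lemma exists_measure_lt_measure_unseparated_lt [Infinite G] [StandardBorelSpace X]
    (hfree : ∀ (g : G) (x : X), g • x = x → g = 1) {g : G} (hg : g ≠ 1)
    {ε : ℝ≥0∞} (hε : 0 < ε) :
    ∃ D : Set X, MeasurableSet D ∧ μ D < ε ∧ μ (unseparated D g) < ε := by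
  classical
  obtain ⟨δ, hδ0, hδε⟩ : ∃ δ : ℝ, 0 < δ ∧ ENNReal.ofReal δ < ε := by
    obtain ⟨δ, h0, h1⟩ := ENNReal.lt_iff_exists_nnreal_btwn.1 hε
    exact ⟨δ, by simpa using h0, by simpa using h1⟩
  obtain ⟨p, m, hp0, hp1, hpm⟩ := exists_sparse_parameters (half_pos hδ0)
  obtain ⟨c, hc, hinj⟩ :=
    MeasurableSpace.measurable_injection_nat_bool_of_countablySeparated X
  let e : ℕ ↪ G := Infinite.natEmbedding G
  let F : Finset G := (Finset.range m).map e
  have hF : F.card = m := by simp [F]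
  let T : Finset G := F ∪ F.image (· * g)
  obtain ⟨M, hM⟩ := exists_measure_not_injOn_smul_lt (μ := μ) hfree hc hinj T
    (ε := ENNReal.ofReal (δ / 2)) (by simpa using hδ0)
  let K := Fin M → Bool
  let π : X → K := fun x i ↦ c x i
  have hπ : Measurable π := measurable_pi_iff.2 fun i ↦ (measurable_pi_apply _).comp hc
  have := isProbabilityMeasure_boolMeasure hp0 hp1
  let P : Measure (K → Bool) := Measure.pi fun _ ↦ boolMeasure p
  -- `B` contains the event that a random set `{x | ω (π x) = true}` fails to separate `x`.
  let B : Set (X × (K → Bool)) := (⋂ h ∈ F, {q | q.2 (π (h • q.1)) = false}) ∪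
    ⋃ h ∈ F, {q | q.2 (π (h • q.1)) = true} ∩ {q | q.2 (π ((h * g) • q.1)) = true}
  have hBmem (x : X) (ω : K → Bool) : (x, ω) ∈ B ↔ (∀ h ∈ F, ω (π (h • x)) = false) ∨
      ∃ h ∈ F, ω (π (h • x)) = true ∧ ω (π ((h * g) • x)) = true := by
    simp only [B, mem_union, mem_iInter, mem_iUnion, mem_inter_iff, mem_ofPred_eq, exists_prop]
  have heval (h : G) (b : Bool) :
      MeasurableSet {q : X × (K → Bool) | q.2 (π (h • q.1)) = b} := by
    have h1 : Measurable fun r : (K → Bool) × K ↦ r.1 r.2 := .of_discrete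
    have h2 : Measurable fun q : X × (K → Bool) ↦ q.2 (π (h • q.1)) :=
      h1.comp (measurable_snd.prodMk (hπ.comp ((measurable_const_smul h).comp measurable_fst)))
    exact h2 (measurableSet_singleton b)
  have hB : MeasurableSet B :=
    .union (F.measurableSet_biInter fun h _ ↦ heval h _)
      (F.measurableSet_biUnion fun h _ ↦ (heval h _).inter (heval _ _))
  have hmean : ∫⁻ ω, μ {x | ω (π x) = true} ∂P = ENNReal.ofReal p := by
    have h1 := heval 1 true
    simp only [one_smul] at h1
    have h2 := Measure.prod_apply (μ := μ) (ν := P) h1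
    rw [Measure.prod_apply_symm h1] at h2
    refine h2.trans ?_
    have h3 (x : X) : P (Prod.mk x ⁻¹' {q : X × (K → Bool) | q.2 (π q.1) = true}) =
        ENNReal.ofReal p := by
      have := pi_setOf_forall_mem_finset (boolMeasure p) {π x} {true}
      simpa [boolMeasure_true] using this
    rw [lintegral_congr h3]
    simp
  have hfail : ∫⁻ ω, μ {x | (x, ω) ∈ B} ∂P ≤
      ENNReal.ofReal ((1 - p) ^ m + m * p ^ 2) + ENNReal.ofReal (δ / 2) := by
    have h2 := Measure.prod_apply (μ := μ) (ν := P) hB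
    rw [Measure.prod_apply_symm hB] at h2
    refine h2.le.trans ?_
    set N : Set X := {x | ¬ InjOn (fun (u : G) (i : Fin M) ↦ c (u • x) i) T} with hN
    have hpt (x : X) : P (Prod.mk x ⁻¹' B) ≤
        ENNReal.ofReal ((1 - p) ^ m + m * p ^ 2) + (toMeasurable μ N).indicator 1 x := by
      by_cases hx : x ∈ N
      · rw [indicator_of_mem (subset_toMeasurable μ N hx)]
        exact prob_le_one.trans le_add_self
      refine le_add_right ?_
      have hx' : InjOn (fun u : G ↦ π (u • x)) T := not_not.1 hx
      have hFT : F ⊆ T := Finset.subset_union_left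
      have hcard : (F.image fun h ↦ π (h • x)).card = m := by
        rw [Finset.card_image_of_injOn (hx'.mono (by exact_mod_cast hFT)), hF]
      have hempty := pi_setOf_forall_mem_finset (boolMeasure p)
        (F.image fun h ↦ π (h • x)) {false}
      rw [hcard, boolMeasure_false] at hempty
      have hpair (h : G) (hh : h ∈ F) : P {ω | ω (π (h • x)) = true ∧
          ω (π ((h * g) • x)) = true} = ENNReal.ofReal p ^ 2 := by
        have hne : π (h • x) ≠ π ((h * g) • x) := fun heq ↦ hg <| by
          have := hx' (hFT hh) (Finset.mem_union_right _ (Finset.mem_image_of_mem _ hh)) heq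
          simpa using this
        have := pi_setOf_forall_mem_finset (boolMeasure p) {π (h • x), π ((h * g) • x)} {true}
        rw [Finset.card_pair hne, boolMeasure_true] at this
        simpa using this
      calc P (Prod.mk x ⁻¹' B)
          ≤ P ({ω | ∀ k ∈ F.image fun h ↦ π (h • x), ω k ∈ ({false} : Set Bool)} ∪
              ⋃ h ∈ F, {ω | ω (π (h • x)) = true ∧ ω (π ((h * g) • x)) = true}) := by
            refine measure_mono ?_
            intro ω hω
            obtain h | ⟨h, hh, h1⟩ := (hBmem x ω).1 hω
            · left
              simpa using h
            · right
              exact mem_iUnion₂.2 ⟨h, hh, h1⟩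
        _ ≤ ENNReal.ofReal (1 - p) ^ m + ∑ h ∈ F, ENNReal.ofReal p ^ 2 := by
            refine (measure_union_le _ _).trans (add_le_add hempty.le ?_)
            refine (measure_biUnion_finset_le _ _).trans (Finset.sum_le_sum fun h hh ↦ ?_)
            exact (hpair h hh).le
        _ = ENNReal.ofReal ((1 - p) ^ m + m * p ^ 2) := by
            rw [Finset.sum_const, hF, nsmul_eq_mul, ENNReal.ofReal_add (by
              have := sub_nonneg.2 hp1; positivity) (by positivity), ENNReal.ofReal_mul
              (by positivity), ENNReal.ofReal_pow (sub_nonneg.2 hp1), ENNReal.ofReal_pow hp0,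
              ENNReal.ofReal_natCast]
    refine (lintegral_mono hpt).trans ?_
    rw [lintegral_add_left measurable_const, lintegral_indicator_one (measurableSet_toMeasurable _ _),
      measure_toMeasurable]
    simp only [lintegral_const, measure_univ, mul_one]
    gcongr
  obtain ⟨ω, hω⟩ := exists_le_lintegral (μ := P)
    (f := fun ω ↦ μ {x | ω (π x) = true} + μ {x | (x, ω) ∈ B})
    (Measurable.of_discrete).aemeasurable
  rw [lintegral_add_left .of_discrete, hmean] at hω
  have hlt : μ {x | ω (π x) = true} + μ {x | (x, ω) ∈ B} < ε := by
    refine (hω.trans (add_le_add_right hfail _)).trans_lt (lt_of_le_of_lt ?_ hδε)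
    rw [← ENNReal.ofReal_add (by have := sub_nonneg.2 hp1; positivity) (by positivity),
      ← ENNReal.ofReal_add hp0 (by have := sub_nonneg.2 hp1; positivity)]
    exact ENNReal.ofReal_le_ofReal (by linarith)
  refine ⟨{x | ω (π x) = true}, hπ (Measurable.of_discrete (measurableSet_singleton true)),
    le_self_add.trans_lt hlt, (measure_mono fun x hx ↦ ?_).trans_lt (le_add_self.trans_lt hlt)⟩
  by_cases h : ∃ h ∈ F, ω (π (h • x)) = true
  · obtain ⟨h, hh, h1⟩ := h
    exact (hBmem x ω).2 <| Or.inr ⟨h, hh, h1, by simpa [mul_smul] using (hx h).1 h1⟩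
  · push Not at h
    exact (hBmem x ω).2 <| Or.inl fun k hk ↦ by simpa using h k hk

/-- A generic set of small measure has almost everywhere free orbit labellings. -/
lemma exists_measure_lt_forall_measure_unseparated_eq_zero [SMulInvariantMeasure G X μ]
    [Countable G] [Infinite G] [StandardBorelSpace X] (hfree : ∀ (g : G) (x : X), g • x = x → g = 1)
    {ε : ℝ≥0∞} (hε : 0 < ε) :
    ∃ A : Set X, MeasurableSet A ∧ μ A < ε ∧ ∀ g : G, g ≠ 1 → μ (unseparated A g) = 0 := by
  let U (q : {g : G // g ≠ 1} × ℕ) : Set (MeasuredSets μ) :=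
    {A | μ (unseparated (A : Set X) (q.1 : G)) < (q.2 : ℝ≥0∞)⁻¹}
  have hopen (q) : IsOpen (U q) := by
    refine EMetric.isOpen_iff.2 fun A hA ↦ ?_
    have hA' : μ (unseparated (A : Set X) (q.1 : G)) < (q.2 : ℝ≥0∞)⁻¹ := hA
    obtain ⟨ρ, hρ, h⟩ := exists_pos_measure_unseparated_symmDiff_diff_lt (μ := μ) A.2 (q.1 : G)
      (tsub_pos_of_lt hA')
    refine ⟨ρ, hρ, fun B hB ↦ ?_⟩
    have hd : μ ((A : Set X) ∆ B) < ρ := by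
      rw [symmDiff_comm]; exact hB
    have hlt := h _ hd
    have hcancel : (A.1 : Set X) ∆ ((A : Set X) ∆ B) = B := symmDiff_symmDiff_cancel_left _ _
    rw [hcancel] at hlt
    calc μ (unseparated (B : Set X) (q.1 : G))
        ≤ μ (unseparated (A : Set X) (q.1 : G)) +
          μ (unseparated (B : Set X) (q.1 : G) \ unseparated (A : Set X) (q.1 : G)) :=
          (measure_mono (by rw [union_sdiff_self]; exact subset_union_right)).trans
            (measure_union_le _ _)
      _ < _ := lt_tsub_iff_left.1 hlt
  have hdense (q) : Dense (U q) := by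
    refine fun A ↦ EMetric.mem_closure_iff.2 fun r hr ↦ ?_
    have hq : 0 < (q.2 : ℝ≥0∞)⁻¹ / 2 := ENNReal.half_pos (by simp)
    obtain ⟨ρ, hρ, h⟩ := exists_pos_measure_unseparated_symmDiff_diff_lt (μ := μ) A.2 (q.1 : G) hq
    obtain ⟨D, hDm, hD, hDsep⟩ := exists_measure_lt_measure_unseparated_lt (μ := μ) hfree q.1.2
      (lt_min hr (lt_min hρ hq))
    refine ⟨⟨(A : Set X) ∆ D, A.2.symmDiff hDm⟩, ?_, ?_⟩
    · calc μ (unseparated ((A : Set X) ∆ D) (q.1 : G))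
          ≤ μ (unseparated D (q.1 : G)) + μ (unseparated ((A : Set X) ∆ D) (q.1 : G) \
            unseparated (A : Set X) (q.1 : G)) := by
            refine (measure_mono fun x hx ↦ ?_).trans (measure_union_le _ _)
            by_cases hxA : x ∈ unseparated (A : Set X) (q.1 : G)
            · refine Or.inl fun k ↦ ?_
              have h1 := hx k
              have h2 := hxA k
              simp only [mem_symmDiff] at h1
              tauto
            · exact Or.inr ⟨hx, hxA⟩
        _ < (q.2 : ℝ≥0∞)⁻¹ / 2 + (q.2 : ℝ≥0∞)⁻¹ / 2 :=
            ENNReal.add_lt_add (hDsep.trans_le ((min_le_right _ _).trans (min_le_right _ _)))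
              (h D (hD.trans_le ((min_le_right _ _).trans (min_le_left _ _))))
        _ = _ := ENNReal.add_halves _
    · change μ ((A : Set X) ∆ ((A : Set X) ∆ D)) < r
      rw [symmDiff_symmDiff_cancel_left]
      exact hD.trans_le (min_le_left _ _)
  obtain ⟨A, hAε, hA⟩ := (dense_iInter_of_isOpen hopen hdense).inter_open_nonempty
    {A : MeasuredSets μ | μ A < ε} (isOpen_lt MeasuredSets.continuous_measure continuous_const)
    ⟨⟨∅, .empty⟩, (measure_empty (μ := μ)).trans_lt hε⟩
  refine ⟨A, A.2, hAε, fun g hg ↦ ?_⟩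
  by_contra hne
  obtain ⟨n, hn⟩ := ENNReal.exists_inv_nat_lt hne
  exact lt_asymm hn (mem_iInter.1 hA (⟨g, hg⟩, n))

end Action

section Shift

variable {G : Type*} [Group G]

/-- The right shift action of `G` on real labellings of `G`, transported along `ι : G ≃ ℕ`. -/
def rightShift (ι : G ≃ ℕ) (g : G) (z : ℕ → ℝ) : ℕ → ℝ := fun n ↦ z (ι (ι.symm n * g))

lemma rightShift_one (ι : G ≃ ℕ) (z : ℕ → ℝ) : rightShift ι 1 z = z := by
  ext n; simp [rightShift]

lemma rightShift_mul (ι : G ≃ ℕ) (g k : G) (z : ℕ → ℝ) :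
    rightShift ι (g * k) z = rightShift ι g (rightShift ι k z) := by
  ext n; simp [rightShift, mul_assoc]

lemma measurable_rightShift (ι : G ≃ ℕ) (g : G) : Measurable (rightShift ι g) :=
  measurable_pi_iff.2 fun _ ↦ measurable_pi_apply _

/-- The free part of the shift. -/
def freePart (ι : G ≃ ℕ) : Set (ℕ → ℝ) := {z | ∀ g, rightShift ι g z = z → g = 1}

lemma rightShift_mem_freePart (ι : G ≃ ℕ) (g : G) {z : ℕ → ℝ} (hz : z ∈ freePart ι) :
    rightShift ι g z ∈ freePart ι := by
  intro k hk
  have := hz (g⁻¹ * k * g) (by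
    rw [mul_assoc, rightShift_mul, rightShift_mul, hk, ← rightShift_mul, inv_mul_cancel,
      rightShift_one])
  simpa [mul_assoc, inv_mul_eq_one] using this

lemma measurableSet_freePart [Countable G] (ι : G ≃ ℕ) : MeasurableSet (freePart ι) := by
  have : freePart ι = ⋂ g : G, {z | rightShift ι g z = z → g = 1} := by
    ext; simp [freePart]
  rw [this]
  exact .iInter fun g ↦ .imp (measurableSet_eq_fun (measurable_rightShift ι g) measurable_id)
    (.const _)

/-- The shift action on its free part. -/
@[reducible] def freePartMulAction (ι : G ≃ ℕ) : MulAction G (freePart ι) where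
  smul g z := ⟨rightShift ι g z, rightShift_mem_freePart ι g z.2⟩
  one_smul z := Subtype.ext (rightShift_one ι z)
  mul_smul g k z := Subtype.ext (rightShift_mul ι g k z)

end Shift

lemma exists_pos_binEntropy_lt {ε : ℝ} (hε : 0 < ε) :
    ∃ δ : ℝ≥0∞, 0 < δ ∧ ∀ p : ℝ≥0∞, p < δ → Real.binEntropy p.toReal < ε := by
  have h : Tendsto (fun p : ℝ≥0∞ ↦ Real.binEntropy p.toReal) (𝓝 0) (𝓝 0) := by
    have h1 := (Real.binEntropy_continuous.tendsto 0).comp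
      (ENNReal.tendsto_toReal ENNReal.zero_ne_top)
    simpa [Function.comp_def] using h1
  obtain ⟨δ, hδ, h⟩ := (ENNReal.nhds_zero_basis.eventually_iff).1 (h.eventually_lt_const hε)
  exact ⟨δ, hδ, fun p hp ↦ h hp⟩

end MeasureTheory

/-- Corollary 2.5: every free probability-measure-preserving action of a countably infinite
group `G` has, for every `ε > 0`, a free factor `G ↷ (Z, η)` admitting a 2-piece generating
partition `{C, Cᶜ}` of Shannon entropy less than `ε`. -/
theorem exists_small_entropy_free_factor
    {G : Type*} [Group G] [Countable G] [Infinite G]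
    {X : Type*} [MeasurableSpace X] [StandardBorelSpace X] [MulAction G X]
    (hBorel : ∀ g : G, Measurable fun x : X => g • x)
    (μ : Measure X) [IsProbabilityMeasure μ]
    (hinv : ∀ (g : G) (A : Set X), MeasurableSet A → μ ((fun x => g • x) '' A) = μ A)
    (hfree : ∀ (g : G) (x : X), g • x = x → g = 1)
    (ε : ℝ) (hε : 0 < ε) :
    ∃ (Z : Type) (_ : MeasurableSpace Z) (_ : StandardBorelSpace Z) (_ : MulAction G Z)
      (η : Measure Z) (f : X → Z),
      (∀ g : G, Measurable fun z : Z => g • z) ∧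
      (∀ (g : G) (z : Z), g • z = z → g = 1) ∧
      IsProbabilityMeasure η ∧
      (∀ (g : G) (A : Set Z), MeasurableSet A → η ((fun z => g • z) '' A) = η A) ∧
      Measurable f ∧
      (∀ (g : G) (x : X), f (g • x) = g • f x) ∧
      Measure.map f μ = η ∧
      ∃ C : Set Z, MeasurableSet C ∧
        -- `{C, Cᶜ}` is a generating partition for `G ↷ (Z, η)`: it separates points of
        -- some `G`-invariant conull Borel set
        (∃ Z₀ : Set Z, MeasurableSet Z₀ ∧ (∀ g : G, (fun z => g • z) '' Z₀ ⊆ Z₀) ∧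
          η Z₀ᶜ = 0 ∧
          ∀ z ∈ Z₀, ∀ z' ∈ Z₀, z ≠ z' → ∃ g : G, ¬((g • z ∈ C) ↔ (g • z' ∈ C))) ∧
        -- Shannon entropy of `{C, Cᶜ}` is less than `ε`
        (-(η C).toReal * Real.log (η C).toReal
          - (η Cᶜ).toReal * Real.log (η Cᶜ).toReal) < ε := by
  classical
  have : MeasurableConstSMul G X := ⟨hBorel⟩
  have : SMulInvariantMeasure G X μ := ⟨fun g s hs ↦ by
    rw [Set.preimage_smul]
    exact hinv g⁻¹ s hs⟩
  obtain ⟨δ, hδ, hent⟩ := exists_pos_binEntropy_lt hε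
  obtain ⟨A, hA, hAδ, hsep⟩ :=
    exists_measure_lt_forall_measure_unseparated_eq_zero (μ := μ) hfree hδ
  obtain ⟨e, he⟩ := exists_measurableEmbedding_real X
  obtain ⟨ι⟩ : Nonempty (G ≃ ℕ) := nonempty_equiv_of_countable
  let N : Set X := ⋃ g : {g : G // g ≠ 1}, unseparated A g.1
  have hN : MeasurableSet N := .iUnion fun g ↦ measurableSet_unseparated hA g.1
  have hN0 : μ N = 0 := measure_iUnion_null fun g ↦ hsep g.1 g.2
  have hNsmul (k : G) (x : X) : k • x ∈ N ↔ x ∈ N := by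
    have key (k : G) (x : X) (hx : x ∈ N) : k • x ∈ N := by
      obtain ⟨g, hg⟩ := mem_iUnion.1 hx
      refine mem_iUnion.2 ⟨⟨k * g.1 * k⁻¹, by simpa [mul_inv_eq_one] using g.2⟩, fun h ↦ ?_⟩
      simpa [mul_smul] using hg (h * k)
    exact ⟨fun h ↦ by simpa using key k⁻¹ _ h, key k x⟩
  let l : X → ℝ := N.piecewise e (A.indicator 1)
  have hl : Measurable l := he.measurable.piecewise hN (measurable_one.indicator hA)
  let φ : X → ℕ → ℝ := fun x n ↦ l (ι.symm n • x)
  have hφ : Measurable φ := measurable_pi_iff.2 fun n ↦ hl.comp (hBorel _)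
  have hφsmul (g : G) (x : X) : φ (g • x) = rightShift ι g (φ x) := by
    ext n; simp [φ, rightShift, mul_smul]
  have hφfree (x : X) : φ x ∈ freePart ι := by
    intro g hg
    rw [← hφsmul] at hg
    have hg' (h : G) : l (h • g • x) = l (h • x) := by
      simpa [φ] using congrFun hg (ι h)
    by_cases hx : x ∈ N
    · have h1 := hg' 1
      simp only [one_smul, l, piecewise_eq_of_mem _ _ _ hx,
        piecewise_eq_of_mem _ _ _ ((hNsmul g x).2 hx)] at h1
      exact hfree g x (he.injective h1)
    · by_contra hne
      refine hx (mem_iUnion.2 ⟨⟨g, hne⟩, fun h ↦ ?_⟩)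
      have h1 := hg' h
      simp only [l, piecewise_eq_of_notMem _ _ _ (mt (hNsmul h x).1 hx),
        piecewise_eq_of_notMem _ _ _ (mt (hNsmul h _).1 (mt (hNsmul g x).1 hx))] at h1
      by_cases ha : h • x ∈ A <;> by_cases hb : h • g • x ∈ A <;> simp_all
  let f : X → freePart ι := fun x ↦ ⟨φ x, hφfree x⟩
  have hf : Measurable f := hφ.subtype_mk
  let _ : MulAction G (freePart ι) := freePartMulAction ι
  have hsmul (g : G) : Measurable fun z : freePart ι ↦ g • z :=
    ((measurable_rightShift ι g).comp measurable_subtype_coe).subtype_mk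
  have hfsmul (g : G) (x : X) : f (g • x) = g • f x := Subtype.ext (hφsmul g x)
  have hsmul_apply (g : G) (z : freePart ι) (n : ℕ) :
      (g • z : freePart ι).1 n = z.1 (ι (ι.symm n * g)) := rfl
  have hprob : IsProbabilityMeasure (μ.map f) := Measure.isProbabilityMeasure_map hf.aemeasurable
  let C : Set (freePart ι) := {z | z.1 (ι 1) = 1}
  have hcoord (n : ℕ) : Measurable fun z : freePart ι ↦ z.1 n :=
    (measurable_pi_apply n).comp measurable_subtype_coe
  have hC : MeasurableSet C := hcoord _ (measurableSet_singleton 1)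
  let Z₀ : Set (freePart ι) := ⋂ n, {z | z.1 n = 0 ∨ z.1 n = 1}
  have hZ₀ : MeasurableSet Z₀ := .iInter fun n ↦
    .union (hcoord n (measurableSet_singleton 0)) (hcoord n (measurableSet_singleton 1))
  have hlN (x : X) (hx : x ∉ N) : l x = A.indicator 1 x := piecewise_eq_of_notMem _ _ _ hx
  refine ⟨freePart ι, inferInstance, (measurableSet_freePart ι).standardBorel, inferInstance,
    μ.map f, f, hsmul, fun g z hz ↦ z.2 g (congrArg Subtype.val hz), hprob, fun g B hB ↦ ?_, hf,
    hfsmul, rfl, C, hC, ⟨Z₀, hZ₀, ?_, ?_, ?_⟩, ?_⟩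
  · have himage : (fun z ↦ g • z) '' B = (fun z ↦ g⁻¹ • z) ⁻¹' B := by
      rw [Set.preimage_smul, inv_inv]
      rfl
    rw [himage, Measure.map_apply hf (hsmul _ hB), Measure.map_apply hf hB,
      ← measure_preimage_smul μ g⁻¹ (f ⁻¹' B)]
    congr 1
    ext x
    simp [hfsmul]
  · rintro g _ ⟨z, hz, rfl⟩
    exact mem_iInter.2 fun n ↦ mem_iInter.1 hz _
  · rw [Measure.map_apply hf hZ₀.compl]
    refine measure_mono_null (fun x hx ↦ ?_) hN0
    by_contra hxN
    refine hx (mem_iInter.2 fun n ↦ ?_)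
    change l (ι.symm n • x) = 0 ∨ l (ι.symm n • x) = 1
    rw [hlN _ (mt (hNsmul _ x).1 hxN)]
    by_cases ha : ι.symm n • x ∈ A <;> simp [ha]
  · intro z hz z' hz' hne
    obtain ⟨n, hn⟩ : ∃ n, z.1 n ≠ z'.1 n := by
      by_contra! hcon
      exact hne (Subtype.ext (funext hcon))
    refine ⟨ι.symm n, fun hiff ↦ hn ?_⟩
    have h1 : z.1 n = 0 ∨ z.1 n = 1 := mem_iInter.1 hz n
    have h2 : z'.1 n = 0 ∨ z'.1 n = 1 := mem_iInter.1 hz' n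
    have h3 : z.1 n = 1 ↔ z'.1 n = 1 := by
      simpa [C, hsmul_apply] using hiff
    grind
  · have hCδ : μ.map f C < δ := by
      rw [Measure.map_apply hf hC]
      refine lt_of_le_of_lt ?_ hAδ
      calc μ (f ⁻¹' C) ≤ μ (A ∪ N) := measure_mono fun x hx ↦ ?_
        _ ≤ μ A + μ N := measure_union_le _ _
        _ = μ A := by rw [hN0, add_zero]
      by_contra hcon
      rw [mem_union, not_or] at hcon
      have hlx : l ((ι.symm (ι 1)) • x) = 1 := hx
      rw [Equiv.symm_apply_apply, one_smul, hlN x hcon.2, indicator_of_notMem hcon.1] at hlx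
      exact zero_ne_one hlx
    have h1 := hent _ hCδ
    have h2 : (μ.map f Cᶜ).toReal = 1 - (μ.map f C).toReal := probReal_compl_eq_one_sub hC
    rw [Real.binEntropy_eq_negMulLog_add_negMulLog_one_sub] at h1
    rw [h2]
    simp only [Real.negMulLog] at h1
    linarith
end

section
/- Let G be a countably infinite group and let G ↷ X be a free Borel action on a standard Borel space X. Let M, R ⊆ X be disjoint Borel sets with M syndetic, let φ : X \ (M ∪ R) → {0,1} be a Borel function, and assume R is φ-recognizable. Fix s ∈ G with s ≠ 1_G. Then there exist Borel sets M', R' ⊆ X and a Borel function φ' : X \ (M' ∪ R' ∪ R) → {0,1} such that: (i) M' and R' are disjoint subsets of M; (ii) φ' extends φ; (iii) M' and R' are both syndetic and R' is φ'-recognizable; (iv) there is a finite set T ⊆ G such that for all x ∈ X the partial functions φ̃'(x)↾T and φ̃'(s·x)↾T are incompatible. -/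
open MeasureTheory Set

/-- `M ⊆ X` is syndetic if `F • M = X` for some finite `F ⊆ G`. -/
def Syndetic {G X : Type*} [Group G] [MulAction G X] (M : Set X) : Prop :=
  ∃ F : Finset G, ∀ x : X, ∃ g ∈ F, g⁻¹ • x ∈ M

/-- `R` is `φ`-recognizable, where the partial function `φ` is represented by its domain
`dom ⊆ X` together with a total (Borel) function `φ : X → Bool` whose values off `dom` are
irrelevant: there is a finite `T ⊆ G` such that for all `x ∈ R` and `y ∉ R` the partial
functions `φ̃(x)↾T` and `φ̃(y)↾T` are incompatible, where `φ̃(x)(g) = φ(g⁻¹ • x)` when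
`g⁻¹ • x ∈ dom` and is undefined otherwise. -/
def Recognizable {G X : Type*} [Group G] [MulAction G X]
    (dom : Set X) (φ : X → Bool) (R : Set X) : Prop :=
  ∃ T : Finset G, ∀ x ∈ R, ∀ y ∉ R, ∃ t ∈ T,
    t⁻¹ • x ∈ dom ∧ t⁻¹ • y ∈ dom ∧ φ (t⁻¹ • x) ≠ φ (t⁻¹ • y)

section Borel

variable {G X : Type*} [Group G] [MeasurableSpace X] [MulAction G X]

/-- A Borel subset `C` of `B` which is maximal among the `S`-separated ones. -/
theorem exists_maximal_separated [StandardBorelSpace X]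
    (hBorel : ∀ g : G, Measurable fun x : X => g • x)
    (hfree : ∀ (g : G) (x : X), g • x = x → g = 1)
    (S : Finset G) (hS : ∀ g ∈ S, g⁻¹ ∈ S) {B : Set X} (hB : MeasurableSet B) :
    ∃ C ⊆ B, MeasurableSet C ∧ (∀ x ∈ C, ∀ g ∈ S, g • x ∈ C → g = 1) ∧
      ∀ x ∈ B, x ∈ C ∨ ∃ g ∈ S, g • x ∈ C := by
  classical
  obtain ⟨f, hf, hfi⟩ := MeasurableSpace.measurable_injection_nat_bool_of_countablySeparated X
  have hfm : ∀ i, Measurable fun x => f x i := fun i => (measurable_pi_apply i).comp hf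
  obtain ⟨e, he⟩ := exists_surjective_nat (Σ n : ℕ, Fin n → Bool)
  let D : (Σ n : ℕ, Fin n → Bool) → Set X := fun s =>
    {x | x ∈ B ∧ (∀ i : Fin s.1, f x i = s.2 i) ∧
      ∀ g ∈ S, g ≠ 1 → ∃ i : Fin s.1, f (g • x) i ≠ s.2 i}
  have hDm : ∀ s, MeasurableSet (D s) := by
    intro s
    refine hB.inter (MeasurableSet.inter ?_ ?_)
    · have : {x | ∀ i : Fin s.1, f x i = s.2 i} = ⋂ i : Fin s.1, {x | f x i = s.2 i} := by
        ext; simp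
      change MeasurableSet {x | ∀ i : Fin s.1, f x i = s.2 i}
      rw [this]
      exact MeasurableSet.iInter fun i => hfm i (measurableSet_singleton _)
    · have : {x | ∀ g ∈ S, g ≠ 1 → ∃ i : Fin s.1, f (g • x) i ≠ s.2 i} =
          ⋂ g ∈ S, ⋂ _ : g ≠ 1, ⋃ i : Fin s.1, {x | f (g • x) i ≠ s.2 i} := by
        ext; simp
      change MeasurableSet {x | ∀ g ∈ S, g ≠ 1 → ∃ i : Fin s.1, f (g • x) i ≠ s.2 i}
      rw [this]
      refine Finset.measurableSet_biInter _ fun g _ => MeasurableSet.iInter fun _ =>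
        MeasurableSet.iUnion fun i => ?_
      exact (((hfm i).comp (hBorel g)) (measurableSet_singleton (s.2 i))).compl
  have hDsep : ∀ s, ∀ x ∈ D s, ∀ g ∈ S, g • x ∈ D s → g = 1 := by
    intro s x hx g hg hgx
    by_contra h
    obtain ⟨i, hi⟩ := hx.2.2 g hg h
    exact hi (hgx.2.1 i)
  have hDcov : ∀ x ∈ B, ∃ s, x ∈ D s := by
    intro x hx
    have h1 : ∀ g : G, ∃ i : ℕ, g ≠ 1 → f (g • x) i ≠ f x i := by
      intro g
      by_cases hg : g = 1
      · exact ⟨0, fun h => absurd hg h⟩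
      · by_contra! hcon
        exact hg (hfree g x (hfi (funext fun i => (hcon i).2)))
    choose i hi using h1
    refine ⟨⟨S.sup i + 1, fun j => f x j⟩, hx, fun _ => rfl, fun g hg hg1 => ?_⟩
    exact ⟨⟨i g, Nat.lt_succ_of_le (Finset.le_sup hg)⟩, hi g hg1⟩
  let acc : ℕ → Set X := fun m => Nat.rec ∅
    (fun m A => A ∪ {x | x ∈ D (e m) ∧ ∀ g ∈ S, g • x ∉ A}) m
  have hacc : ∀ m, acc (m + 1) = acc m ∪ {x | x ∈ D (e m) ∧ ∀ g ∈ S, g • x ∉ acc m} :=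
    fun m => rfl
  have hmono : Monotone acc := monotone_nat_of_le_succ fun m => by
    rw [hacc]; exact subset_union_left
  have haccm : ∀ m, MeasurableSet (acc m) := by
    intro m
    induction m with
    | zero => exact MeasurableSet.empty
    | succ m ih =>
      rw [hacc]
      refine ih.union ((hDm _).inter ?_)
      have : {x | ∀ g ∈ S, g • x ∉ acc m} = ⋂ g ∈ S, (fun x => g • x) ⁻¹' (acc m)ᶜ := by
        ext; simp
      change MeasurableSet {x | ∀ g ∈ S, g • x ∉ acc m}
      rw [this]
      exact Finset.measurableSet_biInter _ fun g _ => hBorel g ih.compl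
  have haccB : ∀ m, acc m ⊆ B := by
    intro m
    induction m with
    | zero => exact empty_subset _
    | succ m ih =>
      rw [hacc]
      exact union_subset ih fun x hx => hx.1.1
  have haccsep : ∀ m, ∀ x ∈ acc m, ∀ g ∈ S, g • x ∈ acc m → g = 1 := by
    intro m
    induction m with
    | zero => intro x hx; exact absurd hx (notMem_empty x)
    | succ m ih =>
      intro x hx g hg hgx
      rw [hacc] at hx hgx
      rcases hx with hx | hx <;> rcases hgx with hgx | hgx
      · exact ih x hx g hg hgx
      · exact absurd (by simpa using hx) (hgx.2 g⁻¹ (hS g hg))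
      · exact absurd hgx (hx.2 g hg)
      · exact hDsep _ x hx.1 g hg hgx.1
  refine ⟨⋃ m, acc m, iUnion_subset haccB, MeasurableSet.iUnion haccm, ?_, ?_⟩
  · intro x hx g hg hgx
    obtain ⟨m, hm⟩ := mem_iUnion.1 hx
    obtain ⟨k, hk⟩ := mem_iUnion.1 hgx
    exact haccsep (max m k) x (hmono (le_max_left _ _) hm) g hg (hmono (le_max_right _ _) hk)
  · intro x hx
    obtain ⟨s, hs⟩ := hDcov x hx
    obtain ⟨m, rfl⟩ := he s
    rcases Classical.em (∃ g : G, g ∈ S ∧ g • x ∈ acc m) with h | h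
    · obtain ⟨g, hg, hgx⟩ := h
      exact Or.inr ⟨g, hg, mem_iUnion.2 ⟨m, hgx⟩⟩
    · push Not at h
      refine Or.inl (mem_iUnion.2 ⟨m + 1, ?_⟩)
      rw [hacc]
      exact Or.inr ⟨hs, h⟩

/-- A Borel colouring with `T.card + 1` colours of the Schreier graph given by `T`. -/
theorem exists_measurable_coloring [StandardBorelSpace X]
    (hBorel : ∀ g : G, Measurable fun x : X => g • x)
    (hfree : ∀ (g : G) (x : X), g • x = x → g = 1)
    (T : Finset G) (hT : ∀ g ∈ T, g⁻¹ ∈ T) :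
    ∃ col : X → Fin (T.card + 1), Measurable col ∧
      ∀ x, ∀ g ∈ T, g ≠ 1 → col (g • x) ≠ col x := by
  classical
  have key : ∀ m : ℕ, ∃ (B : Set X) (col : X → ℕ), MeasurableSet B ∧ Measurable col ∧
      (∀ x ∉ B, col x < m) ∧ (∀ x ∉ B, ∀ g ∈ T, g • x ∉ B → g ≠ 1 → col (g • x) ≠ col x) ∧
      ∀ x ∈ B, ∀ k < m, ∃ g ∈ T, g ≠ 1 ∧ g • x ∉ B ∧ col (g • x) = k := by
    intro m
    induction m with
    | zero =>
      exact ⟨univ, fun _ => 0, MeasurableSet.univ, measurable_const, by simp, by simp, by simp⟩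
    | succ m ih =>
      obtain ⟨B, col, hB, hcol, hlt, hne, hnb⟩ := ih
      obtain ⟨C, hCB, hC, hsep, hmax⟩ := exists_maximal_separated hBorel hfree T hT hB
      refine ⟨B \ C, C.piecewise (fun _ => m) col, hB.diff hC,
        Measurable.piecewise hC measurable_const hcol, ?_, ?_, ?_⟩
      · intro x hx
        by_cases hxC : x ∈ C
        · simp [hxC]
        · have : x ∉ B := fun h => hx ⟨h, hxC⟩
          simpa [hxC] using (hlt x this).trans (Nat.lt_succ_self m)
      · intro x hx g hg hgx hg1
        by_cases hxC : x ∈ C <;> by_cases hgC : g • x ∈ C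
        · exact absurd (hsep x hxC g hg hgC) hg1
        · have : g • x ∉ B := fun h => hgx ⟨h, hgC⟩
          simpa [hxC, hgC] using (hlt _ this).ne
        · have : x ∉ B := fun h => hx ⟨h, hxC⟩
          simpa [hxC, hgC] using (hlt _ this).ne'
        · have h1 : x ∉ B := fun h => hx ⟨h, hxC⟩
          have h2 : g • x ∉ B := fun h => hgx ⟨h, hgC⟩
          simpa [hxC, hgC] using hne x h1 g hg h2 hg1
      · intro x hx k hk
        rcases Nat.lt_succ_iff_lt_or_eq.1 hk with hk | rfl
        · obtain ⟨g, hg, hg1, hgx, hgk⟩ := hnb x hx.1 k hk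
          have : g • x ∉ C := fun h => hgx (hCB h)
          exact ⟨g, hg, hg1, fun h => hgx h.1, by simpa [this] using hgk⟩
        · rcases hmax x hx.1 with h | ⟨g, hg, hgC⟩
          · exact absurd h hx.2
          · refine ⟨g, hg, ?_, fun h => h.2 hgC, by simp [hgC]⟩
            rintro rfl
            exact hx.2 (by simpa using hgC)
  obtain ⟨B, col, -, hcol, hlt, hne, hnb⟩ := key (T.card + 1)
  have hBe : ∀ x, x ∉ B := by
    intro x hx
    choose! g hgT _ _ hgk using hnb x hx
    have hinj : Set.InjOn g (Finset.range (T.card + 1)) := by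
      intro i hi j hj hij
      rw [← hgk i (by simpa using hi), ← hgk j (by simpa using hj), hij]
    have := Finset.card_le_card_of_injOn g (fun i hi => hgT i (by simpa using hi)) hinj
    simp at this
  refine ⟨fun x => ⟨col x, hlt x (hBe x)⟩, ?_, ?_⟩
  · refine measurable_to_countable' fun k => ?_
    have : (fun x => (⟨col x, hlt x (hBe x)⟩ : Fin (T.card + 1))) ⁻¹' {k} = col ⁻¹' {(k : ℕ)} := by
      ext x; simp [Fin.ext_iff]
    rw [this]
    exact hcol (measurableSet_singleton _)
  · intro x g hg hg1 h
    exact hne x (hBe x) g hg (hBe _) hg1 (by simpa using h)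

/-- A Borel set `C`, built greedily from the highest value of `q` downwards, which is separated
and such that each point is close to a point of `C` with at least the same value of `q`. -/
theorem exists_greedy_separated [StandardBorelSpace X]
    (hBorel : ∀ g : G, Measurable fun x : X => g • x)
    (hfree : ∀ (g : G) (x : X), g • x = x → g = 1)
    {q : X → ℕ} (hq : Measurable q) {N : ℕ} (hqN : ∀ x, q x < N)
    (S : ℕ → Finset G) (hS : ∀ v, ∀ g ∈ S v, g⁻¹ ∈ S v) (hS1 : ∀ v, 1 ∈ S v) :
    ∃ C : Set X, MeasurableSet C ∧
      (∀ x ∈ C, ∀ g ∈ S (q x), g • x ∈ C → q x ≤ q (g • x) → g = 1) ∧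
      ∀ y, ∃ g ∈ S (q y), g • y ∈ C ∧ q y ≤ q (g • y) := by
  have key : ∀ k : ℕ, ∃ C : Set X, MeasurableSet C ∧ (∀ x ∈ C, N ≤ q x + k) ∧
      (∀ x ∈ C, ∀ g ∈ S (q x), g • x ∈ C → q x ≤ q (g • x) → g = 1) ∧
      ∀ y, N ≤ q y + k → ∃ g ∈ S (q y), g • y ∈ C ∧ q y ≤ q (g • y) := by
    intro k
    induction k with
    | zero =>
      refine ⟨∅, MeasurableSet.empty, by simp, by simp, fun y hy => ?_⟩
      exact absurd (hqN y) (by omega)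
    | succ k ih =>
      obtain ⟨C, hC, hCk, hsep, hcov⟩ := ih
      by_cases hkN : k < N
      swap
      · refine ⟨C, hC, fun x hx => (hCk x hx).trans (by omega), hsep, fun y _ => hcov y ?_⟩
        omega
      set v := N - (k + 1) with hv
      have hBm : MeasurableSet {x | q x = v ∧ ∀ g ∈ S v, g • x ∉ C} := by
        refine (hq (measurableSet_singleton v)).inter ?_
        have : {x | ∀ g ∈ S v, g • x ∉ C} = ⋂ g ∈ S v, (fun x => g • x) ⁻¹' Cᶜ := by
          ext; simp
        change MeasurableSet {x | ∀ g ∈ S v, g • x ∉ C}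
        rw [this]
        exact Finset.measurableSet_biInter _ fun g _ => hBorel g hC.compl
      obtain ⟨D, hDB, hD, hDsep, hDmax⟩ :=
        exists_maximal_separated hBorel hfree (S v) (hS v) hBm
      refine ⟨C ∪ D, hC.union hD, ?_, ?_, ?_⟩
      · rintro x (hx | hx)
        · exact (hCk x hx).trans (by omega)
        · have := (hDB hx).1
          omega
      · rintro x (hx | hx) g hg (hgx | hgx) hle
        · exact hsep x hx g hg hgx hle
        · have h1 := (hDB hgx).1
          have h2 := hCk x hx
          omega
        · rw [(hDB hx).1] at hg
          exact absurd hgx ((hDB hx).2 g hg)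
        · rw [(hDB hx).1] at hg
          exact hDsep x hx g hg hgx
      · intro y hy
        by_cases hyk : N ≤ q y + k
        · obtain ⟨g, hg, hgy, hle⟩ := hcov y hyk
          exact ⟨g, hg, Or.inl hgy, hle⟩
        · have hyv : q y = v := by omega
          by_cases hyB : ∀ g ∈ S v, g • y ∉ C
          · rcases hDmax y ⟨hyv, hyB⟩ with h | ⟨g, hg, hgy⟩
            · exact ⟨1, hS1 _, by simpa using Or.inr h, by simp⟩
            · exact ⟨g, hyv ▸ hg, Or.inr hgy, by rw [(hDB hgy).1, hyv]⟩
          · push Not at hyB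
            obtain ⟨g, hg, hgy⟩ := hyB
            refine ⟨g, hyv ▸ hg, Or.inl hgy, ?_⟩
            have := hCk _ hgy
            omega
  obtain ⟨C, hC, -, hsep, hcov⟩ := key N
  exact ⟨C, hC, hsep, fun y => hcov y (by omega)⟩

/-- A set depending only on finitely many finitely valued Borel data is Borel. -/
theorem measurableSet_of_finite_data {ι α : Type*} [Finite ι] [Finite α] {f : X → ι → α}
    (hf : ∀ i a, MeasurableSet {x | f x i = a}) (s : Set (ι → α)) :
    MeasurableSet {x | f x ∈ s} := by
  have : {x | f x ∈ s} = ⋃ u ∈ s, ⋂ i, {x | f x i = u i} := by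
    ext x
    simp only [mem_ofPred_eq, mem_iUnion, mem_iInter, exists_prop]
    refine ⟨fun h => ⟨f x, h, fun _ => rfl⟩, fun ⟨u, hu, h⟩ => ?_⟩
    rwa [funext h]
  rw [this]
  exact (Set.toFinite s).measurableSet_biUnion fun u _ => MeasurableSet.iInter fun i => hf i _

/-- A Borel choice of an element of `F` moving a given point into `M`. -/
theorem exists_measurable_pick (hBorel : ∀ g : G, Measurable fun x : X => g • x)
    {M : Set X} (hM : MeasurableSet M) (F : Finset G) (hF : ∀ x : X, ∃ g ∈ F, g • x ∈ M) :
    ∃ pick : X → G, (∀ x, pick x ∈ F ∧ pick x • x ∈ M) ∧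
      ∀ g, MeasurableSet {x | pick x = g} := by
  classical
  let f : X → F → Bool := fun x g => decide ((g : G) • x ∈ M)
  let p : (F → Bool) → G := fun u => if h : ∃ g : F, u g = true then (h.choose : G) else 1
  refine ⟨fun x => p (f x), fun x => ?_, fun g => ?_⟩
  · obtain ⟨g, hg, hgx⟩ := hF x
    have h : ∃ g : F, f x g = true := ⟨⟨g, hg⟩, by simpa [f] using hgx⟩
    have hp : p (f x) = h.choose := dif_pos h
    change p (f x) ∈ F ∧ p (f x) • x ∈ M
    rw [hp]
    exact ⟨h.choose.2, by simpa [f] using h.choose_spec⟩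
  · refine measurableSet_of_finite_data (f := f) (fun i a => ?_) {u | p u = g}
    cases a
    · have : {x | f x i = false} = (fun x => (i : G) • x) ⁻¹' Mᶜ := by ext; simp [f]
      rw [this]; exact hBorel _ hM.compl
    · have : {x | f x i = true} = (fun x => (i : G) • x) ⁻¹' M := by ext; simp [f]
      rw [this]; exact hBorel _ hM

end Borel

section Group

open scoped Pointwise

variable {G : Type*} [Group G]

/-- In an infinite group one can choose three core points and infinitely many block positions
which are far apart from each other: only translates by elements of `H` may map all three core
points close to core and block points. -/
theorem exists_core_and_blocks [Countable G] [Infinite G] (F : Finset G) (h1 : 1 ∈ F) :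
    ∃ (b : Fin 3 → G) (d : G ⊕ ℕ → G) (A₁ H : Finset G),
      (∀ f ∈ F, ∀ i, f * b i ∈ A₁) ∧
      1 ∈ H ∧ (∀ h ∈ H, h⁻¹ ∈ H) ∧
      (∀ f ∈ F, ∀ f' ∈ F, ∀ j j', ∀ σ ∈ H, ∀ σ' ∈ H,
        f * d j * σ = f' * d j' * σ' → j = j') ∧
      (∀ f ∈ F, ∀ j, ∀ σ ∈ H, f * d j * σ ∉ A₁) ∧
      ∀ (shift : G ⊕ ℕ → G), (∀ j, shift j ∈ H) → ∀ g, (∀ i, ∃ f ∈ F, f * b i * g ∈ A₁ ∨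
        ∃ j, ∃ f' ∈ F, f * b i * g = f' * d j ∨ f * b i * g = f' * d j * shift j) → g ∈ H := by
  classical
  set E := F⁻¹ * F * (F⁻¹ * F) with hE
  have hEinv : E⁻¹ = E := by simp [hE, mul_inv_rev]
  obtain ⟨b', -, hb'⟩ := exists_seq_of_forall_finset_exists (fun _ : G => True)
    (fun x y => y * x⁻¹ ∉ E) (fun s _ => by
      obtain ⟨y, hy⟩ := Infinite.exists_notMem_finset (E * s)
      refine ⟨y, trivial, fun x hx h => hy ?_⟩
      simpa using Finset.mul_mem_mul h hx)
  have hb : ∀ i j : Fin 3, i ≠ j → b' j * (b' i)⁻¹ ∉ E := by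
    intro i j hij
    rcases lt_or_gt_of_ne hij with h | h
    · exact hb' _ _ h
    · intro hmem
      refine hb' _ _ h ?_
      rw [← hEinv]
      simpa using hmem
  set A₁ := F * Finset.univ.image (fun i : Fin 3 => b' i) with hA₁
  have hA₁mem : ∀ f ∈ F, ∀ i : Fin 3, f * b' i ∈ A₁ := fun f hf i =>
    Finset.mul_mem_mul hf (Finset.mem_image_of_mem _ (Finset.mem_univ i))
  have hA₁1 : b' 0 ∈ A₁ := by simpa using hA₁mem 1 h1 0
  set H := A₁⁻¹ * A₁ with hH
  have hHinv : ∀ h ∈ H, h⁻¹ ∈ H := by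
    intro h hh
    have : H⁻¹ = H := by simp [hH, mul_inv_rev]
    rw [← this]
    simpa using hh
  have hH1 : 1 ∈ H := by
    have := Finset.mul_mem_mul (Finset.inv_mem_inv hA₁1) hA₁1
    rwa [inv_mul_cancel] at this
  set K := A₁⁻¹ * F with hK
  obtain ⟨d', hdH, hd'⟩ := exists_seq_of_forall_finset_exists
    (fun y : G => ∀ k ∈ K, ∀ h ∈ H, k * y * h ∉ H)
    (fun x y => ∀ k ∈ K, ∀ h ∈ H, ∀ k' ∈ K, ∀ h' ∈ H, k * x * h ≠ k' * y * h') (fun s _ => by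
      obtain ⟨y, hy⟩ := Infinite.exists_notMem_finset (K⁻¹ * H * H⁻¹ ∪ K⁻¹ * (K * s * H) * H⁻¹)
      rw [Finset.mem_union, not_or] at hy
      refine ⟨y, fun k hk h hh hkh => hy.1 ?_, fun x hx k hk h hh k' hk' h' hh' heq => hy.2 ?_⟩
      · have : y = k⁻¹ * (k * y * h) * h⁻¹ := by group
        rw [this]
        exact Finset.mul_mem_mul (Finset.mul_mem_mul (Finset.inv_mem_inv hk) hkh)
          (Finset.inv_mem_inv hh)
      · have : y = k'⁻¹ * (k' * y * h') * h'⁻¹ := by group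
        rw [this, ← heq]
        exact Finset.mul_mem_mul (Finset.mul_mem_mul (Finset.inv_mem_inv hk')
          (Finset.mul_mem_mul (Finset.mul_mem_mul hk hx) hh)) (Finset.inv_mem_inv hh'))
  obtain ⟨ι, hι⟩ := Countable.exists_injective_nat (G ⊕ ℕ)
  have hdis : ∀ j j', ∀ k ∈ K, ∀ h ∈ H, ∀ k' ∈ K, ∀ h' ∈ H,
      k * d' (ι j) * h = k' * d' (ι j') * h' → j = j' := by
    intro j j' k hk h hh k' hk' h' hh' heq
    by_contra hne
    rcases lt_or_gt_of_ne (hι.ne hne) with hlt | hlt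
    · exact hd' _ _ hlt k hk h hh k' hk' h' hh' heq
    · exact hd' _ _ hlt k' hk' h' hh' k hk h hh heq.symm
  have hKF : ∀ a ∈ A₁, ∀ f ∈ F, a⁻¹ * f ∈ K := fun a ha f hf =>
    Finset.mul_mem_mul (Finset.inv_mem_inv ha) hf
  refine ⟨fun i => b' i, fun j => d' (ι j), A₁, H, hA₁mem, hH1, hHinv, ?_, ?_, ?_⟩
  · intro f hf f' hf' j j' σ hσ σ' hσ' heq
    refine hdis j j' _ (hKF _ hA₁1 f hf) σ hσ _ (hKF _ hA₁1 f' hf') σ' hσ' ?_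
    simp only [mul_assoc] at heq ⊢
    rw [heq]
  · intro f hf j σ hσ hmem
    refine hdH (ι j) _ (hKF _ hA₁1 f hf) σ hσ ?_
    have := Finset.mul_mem_mul (Finset.inv_mem_inv hA₁1) hmem
    simpa only [mul_assoc] using this
  · intro shift hshift g hg
    by_contra hgH
    have h2 : ∀ i : Fin 3, ∃ f ∈ F, ∃ j, ∃ f' ∈ F, ∃ u : Bool,
        f * b' i * g = f' * d' (ι j) * (if u then 1 else shift j) := by
      intro i
      obtain ⟨f, hf, h | ⟨j, f', hf', h | h⟩⟩ := hg i
      · refine absurd ?_ hgH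
        have := Finset.mul_mem_mul (Finset.inv_mem_inv (hA₁mem f hf i)) h
        rwa [inv_mul_cancel_left] at this
      · exact ⟨f, hf, j, f', hf', true, by simpa using h⟩
      · exact ⟨f, hf, j, f', hf', false, by simpa using h⟩
    choose f hf j f' hf' u hu using h2
    have hσ : ∀ i, (if u i then 1 else shift (j i)) ∈ H := by
      intro i
      split_ifs
      exacts [hH1, hshift _]
    have hg' : ∀ i, g = (f i * b' i)⁻¹ * f' i * d' (ι (j i)) *
        (if u i then 1 else shift (j i)) := by
      intro i
      rw [mul_assoc, mul_assoc, ← mul_assoc (f' i), ← hu i, inv_mul_cancel_left]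
    have hj : ∀ i i', j i = j i' := by
      intro i i'
      refine hdis _ _ _ (hKF _ (hA₁mem _ (hf i) i) _ (hf' i)) _ (hσ i) _
        (hKF _ (hA₁mem _ (hf i') i') _ (hf' i')) _ (hσ i') ?_
      rw [← hg' i, ← hg' i']
    obtain ⟨i, i', hne, huu⟩ := Fintype.exists_ne_map_eq_of_card_lt u (by simp)
    refine hb i i' hne ?_
    have e1 := hu i
    have e2 := hu i'
    rw [← huu, ← hj i i'] at e2
    have e3 : (f i' * b' i' * g) * (f i * b' i * g)⁻¹ = f' i' * (f' i)⁻¹ := by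
      rw [e1, e2]; group
    have e4 : b' i' * (b' i)⁻¹ = (f i')⁻¹ * f' i' * ((f' i)⁻¹ * f i) := by
      have : b' i' * (b' i)⁻¹ = (f i')⁻¹ * ((f i' * b' i' * g) * (f i * b' i * g)⁻¹) * f i := by
        group
      rw [this, e3]; group
    rw [e4]
    exact Finset.mul_mem_mul (Finset.mul_mem_mul (Finset.inv_mem_inv (hf i')) (hf' i'))
      (Finset.mul_mem_mul (Finset.inv_mem_inv (hf' i)) (hf i))

theorem exists_mul_sq_le_two_pow (C : ℕ) : ∃ n : ℕ, C * (n + 2) ^ 2 ≤ 2 ^ n := by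
  have h := tendsto_pow_const_div_const_pow_of_one_lt 2 (one_lt_two : (1 : ℝ) < 2)
  have h' := (h.comp (Filter.tendsto_add_atTop_nat 2)).eventually
    (gt_mem_nhds (show (0 : ℝ) < 1 / (4 * C + 1) by positivity))
  obtain ⟨n, hn⟩ := h'.exists
  refine ⟨n, ?_⟩
  simp only [Function.comp] at hn
  rw [div_lt_div_iff₀ (by positivity) (by positivity), pow_add] at hn
  push_cast at hn
  have : (C : ℝ) * (n + 2) ^ 2 ≤ 2 ^ n := by nlinarith [sq_nonneg ((n : ℝ) + 2)]
  exact_mod_cast this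

end Group

section Pattern

variable {A : Type*}

/-- The pattern `p` fills in the partial data `d`: where `d` is undetermined, `p` takes a Boolean
value, and elsewhere it agrees with `d`. -/
def Fills (d : A → Option (Option Bool)) (p : A → Option Bool) : Prop :=
  ∀ a, (d a = none → p a ≠ none) ∧ ∀ o, d a = some o → p a = o

/-- An injective ranking of patterns for which the highest ranking pattern filling in some given
data takes the value `true` on the core and lies in `Q`, whenever this is possible. -/
theorem exists_ranking [Fintype A] (core : Finset A) (Q : Set (A → Option Bool)) :
    ∃ (val : (A → Option Bool) → ℕ) (best : (A → Option (Option Bool)) → A → Option Bool),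
      val.Injective ∧ ∀ d, Fills d (best d) ∧ (∀ p, Fills d p → val p ≤ val (best d)) ∧
        ((∃ p, Fills d p ∧ p ∈ Q ∧ ∀ a ∈ core, d a = none → p a = some true) →
          best d ∈ Q ∧ ∀ a ∈ core, d a = none → best d a = some true) := by
  classical
  let trues : (A → Option Bool) → Finset A := fun p => {a ∈ core | p a = some true}
  let key : (A → Option Bool) → ℕ := fun p => 2 * (trues p).card + if p ∈ Q then 1 else 0
  let K := Fintype.card (A → Option Bool)
  let e := Fintype.equivFin (A → Option Bool)
  let val : (A → Option Bool) → ℕ := fun p => e p + K * key p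
  have hK : 0 < K := Fintype.card_pos
  have hkey : ∀ p, val p / K = key p := fun p => by
    simp only [val]
    rw [Nat.add_mul_div_left _ _ hK, Nat.div_eq_of_lt (e p).2, zero_add]
  have hmod : ∀ p, val p % K = e p := fun p => by
    simp only [val]
    rw [Nat.add_mul_mod_self_left, Nat.mod_eq_of_lt (e p).2]
  have hbest : ∀ d, ∃ p, Fills d p ∧ ∀ p', Fills d p' → val p' ≤ val p := by
    intro d
    have hne : ({p | Fills d p} : Finset (A → Option Bool)).Nonempty := by
      refine ⟨fun a => (d a).getD (some false), ?_⟩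
      simp only [Finset.mem_filter, Finset.mem_univ, true_and]
      exact fun a => ⟨fun h => by simp [h], fun o h => by simp [h]⟩
    obtain ⟨p, hp, hmax⟩ := Finset.exists_max_image _ val hne
    simp only [Finset.mem_filter, Finset.mem_univ, true_and] at hp hmax
    exact ⟨p, hp, hmax⟩
  choose best hfill hmax using hbest
  refine ⟨val, best, fun p p' h => ?_, fun d => ⟨hfill d, hmax d, ?_⟩⟩
  · have : (e p : ℕ) = e p' := by rw [← hmod, ← hmod, h]
    exact e.injective (Fin.ext this)
  · rintro ⟨p, hp, hpQ, hpc⟩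
    have hle : key p ≤ key (best d) := by
      rw [← hkey, ← hkey]
      exact Nat.div_le_div_right (hmax d p hp)
    have hsub : trues (best d) ⊆ trues p := by
      intro a ha
      simp only [trues, Finset.mem_filter] at ha ⊢
      refine ⟨ha.1, ?_⟩
      rcases hd : d a with _ | o
      · exact hpc a ha.1 hd
      · rw [(hp a).2 o hd, ← (hfill d a).2 o hd]
        exact ha.2
    have hcard := Finset.card_le_card hsub
    simp only [key, hpQ, if_true] at hle
    have hQ : best d ∈ Q := by
      by_contra h
      simp only [h, if_false] at hle
      omega
    refine ⟨hQ, fun a ha hd => ?_⟩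
    simp only [hQ, if_true] at hle
    have heq := Finset.eq_of_subset_of_card_le hsub (by omega)
    have : a ∈ trues p := by
      simp only [trues, Finset.mem_filter]
      exact ⟨ha, hpc a ha hd⟩
    rw [← heq] at this
    exact (Finset.mem_filter.1 this).2

end Pattern

section Fill

/-- Given partial data which are undetermined at the positions `u i`, there is a pattern filling
them in which takes the value `true` on the core and distinguishes `u i` from `v i`. -/
theorem exists_fills_ne {ι A : Type*} (d : A → Option (Option Bool)) (core : Finset A)
    (u v : ι → A) (hu : u.Injective) (huv : ∀ i j, v i ≠ u j) (hcore : ∀ i, u i ∉ core)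
    (hd : ∀ i, d (u i) = none) :
    ∃ p, Fills d p ∧ (∀ i, p (u i) ≠ p (v i)) ∧ ∀ a ∈ core, d a = none → p a = some true := by
  classical
  let base : A → Option Bool := fun a => (d a).getD (some (decide (a ∈ core)))
  let opp : Option Bool → Option Bool := fun o => if o = some true then some false else some true
  have hopp : ∀ o, opp o ≠ o := by decide
  have hopp' : ∀ o, opp o ≠ none := by decide
  let p : A → Option Bool := fun a => if h : ∃ i, a = u i then opp (base (v h.choose)) else base a
  have hpu : ∀ i, p (u i) = opp (base (v i)) := by
    intro i
    have h : ∃ j, u i = u j := ⟨i, rfl⟩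
    have hp : p (u i) = opp (base (v h.choose)) := dif_pos h
    rw [hp, ← hu h.choose_spec]
  have hpn : ∀ a, (∀ i, a ≠ u i) → p a = base a := fun a ha =>
    dif_neg (by push Not; exact ha)
  refine ⟨p, fun a => ?_, fun i => ?_, fun a ha hda => ?_⟩
  · by_cases h : ∃ i, a = u i
    · obtain ⟨i, rfl⟩ := h
      rw [hpu, hd]
      exact ⟨fun _ => hopp' _, fun o h => by simp at h⟩
    · push Not at h
      rw [hpn a h]
      exact ⟨fun h' => by simp [base, h'], fun o h' => by simp [base, h']⟩
  · rw [hpu, hpn _ (huv i)]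
    exact hopp _
  · rw [hpn a fun i h => hcore i (h ▸ ha)]
    simp [base, hda, ha]

end Fill

section Recognition

variable {G X : Type*} [Group G] [MulAction G X]

/-- The partial function given by `φ` on `dom` has compatible traces at `x` and `y` along `T`. -/
def Agree (dom : Set X) (φ : X → Bool) (T : Finset G) (x y : X) : Prop :=
  ∀ t ∈ T, t • x ∈ dom → t • y ∈ dom → φ (t • x) = φ (t • y)

theorem Agree.symm {dom : Set X} {φ : X → Bool} {T : Finset G} {x y : X}
    (h : Agree dom φ T x y) : Agree dom φ T y x := fun t ht hy hx => (h t ht hx hy).symm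

theorem Agree.mono {dom : Set X} {φ : X → Bool} {T T' : Finset G} {x y : X}
    (h : Agree dom φ T' x y) (hT : T ⊆ T') : Agree dom φ T x y := fun t ht => h t (hT ht)

theorem Agree.smul {dom : Set X} {φ : X → Bool} {T T' : Finset G} {x y : X} {g : G}
    (h : Agree dom φ T' x y) (hT : ∀ t ∈ T, t * g ∈ T') : Agree dom φ T (g • x) (g • y) := by
  intro t ht
  simpa only [mul_smul] using h _ (hT t ht)

/-- If compatible traces along `T₁` of a point of the greedy set `C` and of `y` imply the local
conditions in `hT₁`, then membership in `C` is recognized by traces along some finite set. -/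
theorem exists_agree_mem_of_greedy {dom : Set X} {φ : X → Bool} {C : Set X} {q : X → ℕ} {N : ℕ}
    (hqN : ∀ x, q x < N) {S : ℕ → Finset G} {H : Finset G}
    (hHinv : ∀ h ∈ H, h⁻¹ ∈ H) (hHS : ∀ v, v < N → H ⊆ S v)
    (hSH : ∀ u v, u < v → v < N → ∀ g ∈ S v, ∀ h ∈ H, g * h ∈ S u)
    (hSanti : ∀ u v, u ≤ v → v < N → S v ⊆ S u)
    (hsep : ∀ x ∈ C, ∀ g ∈ S (q x), g • x ∈ C → q x ≤ q (g • x) → g = 1)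
    (hcov : ∀ y, ∃ g ∈ S (q y), g • y ∈ C ∧ q y ≤ q (g • y))
    {T₁ : Finset G} (hT₁ : ∀ x ∈ C, ∀ y, Agree dom φ T₁ x y → q x ≤ q y ∧
      (q x = q y → ∃ g ∈ H, ∃ r ∈ C, y = g • r ∧ (q r = q x → y = r))) :
    ∃ T : Finset G, ∀ x ∈ C, ∀ y, Agree dom φ T x y → y ∈ C := by
  classical
  have key : ∀ k : ℕ, ∃ T : Finset G, T₁ ⊆ T ∧
      ∀ x ∈ C, N ≤ q x + k → ∀ y, Agree dom φ T x y → y ∈ C := by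
    intro k
    induction k with
    | zero => exact ⟨T₁, subset_rfl, fun x _ hx => absurd (hqN x) (by omega)⟩
    | succ k ih =>
      obtain ⟨T, hT₁T, hT⟩ := ih
      refine ⟨T₁ ∪ (S 0).biUnion fun g => T.image (· * g), Finset.subset_union_left,
        fun x hx hxk y hxy => ?_⟩
      have hS0 : ∀ v, v < N → S v ⊆ S 0 := fun v hv => hSanti 0 v (Nat.zero_le v) hv
      have htrans : ∀ g ∈ S 0, Agree dom φ T (g • x) (g • y) := fun g hg =>
        hxy.smul fun t ht => Finset.mem_union_right _
          (Finset.mem_biUnion.2 ⟨g, hg, Finset.mem_image_of_mem _ ht⟩)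
      have hmove : ∀ g ∈ S (q x), g • y ∈ C → q x < q (g • y) → y ∈ C := by
        intro g hg hgy hlt
        have h1 := (htrans g (hS0 _ (hqN x) hg)).symm
        have h2 : g • x ∈ C := hT _ hgy (by omega) _ h1
        have h3 := (hT₁ _ hgy _ (h1.mono hT₁T)).1
        have := hsep x hx g hg h2 (by omega)
        rw [this, one_smul] at hgy
        exact hgy
      obtain ⟨hle, heq⟩ := hT₁ x hx y (hxy.mono Finset.subset_union_left)
      rcases hle.lt_or_eq with hlt | hxy'
      · obtain ⟨g, hg, hgy, hgq⟩ := hcov y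
        exact hmove g (hSanti _ _ hlt.le (hqN y) hg) hgy (by omega)
      · obtain ⟨g, hg, r, hr, hyr, hrx⟩ := heq hxy'
        rcases lt_trichotomy (q r) (q x) with h | h | h
        · obtain ⟨g', hg', hgy, hgq⟩ := hcov y
          rw [hyr, ← mul_smul] at hgy
          rw [hyr, ← mul_smul, ← hyr] at hgq
          have h1 := hsep r hr _ (hSH (q r) (q y) (by omega) (hqN y) g' hg' g hg) hgy (by omega)
          rw [h1, one_smul] at hgq
          omega
        · rw [hrx h]
          exact hr
        · have hgr : g⁻¹ • y = r := by rw [hyr, inv_smul_smul]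
          refine hmove g⁻¹ (hHS _ (hqN x) (hHinv g hg)) ?_ ?_
          · rwa [hgr]
          · rwa [hgr]
  obtain ⟨T, -, hT⟩ := key N
  exact ⟨T, fun x hx y => hT x hx (by omega) y⟩

end Recognition

section Construction

variable {G X : Type*} [Group G] [MulAction G X]

open Classical in
/-- The part of the extended function near `x` which is determined by `φ`, as a function on `A`:
points of `M` are undetermined, and points of `R` remain outside of the domain. -/
noncomputable def knownData (M R : Set X) (φ : X → Bool) (A : Finset G) (x : X) :
    A → Option (Option Bool) := fun a =>
  if (a : G) • x ∈ M then none else if (a : G) • x ∈ R then some none else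
    some (some (φ ((a : G) • x)))

theorem measurableSet_knownData [MeasurableSpace X]
    (hBorel : ∀ g : G, Measurable fun x : X => g • x) {M R : Set X} (hM : MeasurableSet M)
    (hR : MeasurableSet R) {φ : X → Bool} (hφ : Measurable φ) (A : Finset G)
    (s : Set (A → Option (Option Bool))) : MeasurableSet {x | knownData M R φ A x ∈ s} := by
  classical
  refine measurableSet_of_finite_data (fun a o => ?_) s
  let _ : MeasurableSpace (Option (Option Bool)) := ⊤
  have : Measurable fun y : X => if y ∈ M then (none : Option (Option Bool)) else
      if y ∈ R then some none else some (some (φ y)) := by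
    refine Measurable.ite hM measurable_const (Measurable.ite hR measurable_const ?_)
    exact (measurable_of_countable fun v : Bool => some (some v)).comp hφ
  exact (this.comp (hBorel a)) (measurableSet_singleton o)

theorem measurableSet_filter_mem [MeasurableSpace X] {α : Type*} (F : Finset α)
    (p : X → α → Prop) [∀ x, DecidablePred (p x)] (hp : ∀ f, MeasurableSet {x | p x f})
    (s : Set (Finset α)) : MeasurableSet {x | F.filter (p x) ∈ s} := by
  classical
  have h1 : ∀ B ⊆ F, MeasurableSet {x | F.filter (p x) = B} := by
    intro B hB
    have : {x | F.filter (p x) = B} = ⋂ f ∈ F, {x | p x f ↔ f ∈ B} := by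
      ext x
      simp only [mem_ofPred_eq, mem_iInter, Finset.ext_iff, Finset.mem_filter]
      refine ⟨fun h f hf => by simpa [hf] using h f, fun h f => ?_⟩
      by_cases hf : f ∈ F
      · simpa [hf] using h f hf
      · simpa [hf] using fun h => hf (hB h)
    rw [this]
    refine Finset.measurableSet_biInter _ fun f _ => ?_
    by_cases hf : f ∈ B
    · simpa [hf] using hp f
    · simp only [hf, iff_false]
      exact (hp f).compl
  have h2 : {x | F.filter (p x) ∈ s} =
      ⋃ B ∈ F.powerset, ⋃ _ : B ∈ s, {x | F.filter (p x) = B} := by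
    ext x
    simp
  rw [h2]
  exact Finset.measurableSet_biUnion _ fun B hB =>
    MeasurableSet.iUnion fun _ => h1 B (Finset.mem_powerset.1 hB)

theorem measurableSet_exists_inv_smul [Countable G] [MeasurableSpace X]
    (hBorel : ∀ g : G, Measurable fun x : X => g • x) {p : G → X → Prop}
    (hp : ∀ g, MeasurableSet {x | p g x}) : MeasurableSet {z | ∃ g : G, p g (g⁻¹ • z)} := by
  have : {z | ∃ g : G, p g (g⁻¹ • z)} = ⋃ g : G, (fun z => g⁻¹ • z) ⁻¹' {x | p g x} := by
    ext; simp
  rw [this]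
  exact MeasurableSet.iUnion fun g => hBorel _ (hp g)

open Classical in
/-- The extension of `φ` obtained from a separated set `C` by writing the patterns `P c` around the
points `c ∈ C`, leaving one point in each of two blocks undefined, and writing the bits `code c k`
as the parities of further blocks. -/
theorem exists_extension [Countable G] [MeasurableSpace X]
    (hBorel : ∀ g : G, Measurable fun x : X => g • x)
    {M R : Set X} (hM : MeasurableSet M) (hMR : Disjoint M R)
    {φ : X → Bool} (hφ : Measurable φ) (hR : MeasurableSet R) {A F : Finset G} {e : ℕ → G} {n : ℕ}
    (heA : ∀ f ∈ F, ∀ k, f * e k ∉ A)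
    (hee : ∀ f ∈ F, ∀ f' ∈ F, ∀ k k', f * e k = f' * e k' → k = k')
    {pick : X → G} (hpick : ∀ x, pick x ∈ F ∧ pick x • x ∈ M)
    (hpickm : ∀ g, MeasurableSet {x | pick x = g})
    {P : X → A → Option Bool} (hP : ∀ x, Fills (knownData M R φ A x) (P x))
    (hPm : ∀ a o, MeasurableSet {x | P x a = o})
    {C : Set X} (hC : MeasurableSet C) {W : Finset G} (hAW : A ⊆ W)
    (hFW : ∀ f ∈ F, ∀ k < n + 2, f * e k ∈ W)
    (hsep : ∀ c ∈ C, ∀ c' ∈ C, ∀ w ∈ W, ∀ w' ∈ W, w • c = w' • c' → w = w' ∧ c = c')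
    {code : X → ℕ → Bool} (hcode : ∀ k, MeasurableSet {x | code x k = true}) :
    ∃ (M' R' : Set X) (φ' : X → Bool),
      MeasurableSet M' ∧ MeasurableSet R' ∧ Measurable φ' ∧
      Disjoint M' R' ∧ M' ⊆ M ∧ R' ⊆ M ∧ (∀ x ∈ (M ∪ R)ᶜ, φ' x = φ x) ∧
      (∀ z, z ∈ R' ↔ ∃ c ∈ C, z = (pick (e 0 • c) * e 0) • c) ∧
      (∀ z, z ∈ M' ↔ ∃ c ∈ C, z = (pick (e 1 • c) * e 1) • c) ∧
      (∀ c ∈ C, ∀ a : A, ((a : G) • c ∈ R ∧ P c a = none) ∨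
        ((a : G) • c ∈ (M' ∪ R' ∪ R)ᶜ ∧ P c a = some (φ' ((a : G) • c)))) ∧
      (∀ z ∈ M, z ∉ (M' ∪ R' ∪ R)ᶜ ∨ φ' z = true → ∃ w ∈ W, ∃ c ∈ C, z = w • c) ∧
      ∀ k < n, ∀ c ∈ C, (∀ f ∈ F, (f * e (k + 2)) • c ∈ R ∨
        (f * e (k + 2)) • c ∈ (M' ∪ R' ∪ R)ᶜ) ∧
        (code c k = true ↔ Odd (F.filter fun f => (f * e (k + 2)) • c ∈ Rᶜ ∩ φ' ⁻¹' {true}).card)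
      := by
  let pt : ℕ → X → G := fun k c => pick (e k • c) * e k
  have hptW : ∀ k < n + 2, ∀ c, pt k c ∈ W := fun k hk c => hFW _ (hpick _).1 k hk
  have hptM : ∀ k c, pt k c • c ∈ M := fun k c => by
    simpa only [pt, mul_smul] using (hpick (e k • c)).2
  have hptA : ∀ k c, pt k c ∉ A := fun k c => heA _ (hpick _).1 k
  have hptF : ∀ k c f, f ∈ F → ∀ k', f * e k' = pt k c → k' = k := fun k c f hf k' h =>
    hee f hf _ (hpick _).1 k' k h
  have hptm : ∀ k g, MeasurableSet {c | pt k c = g} := by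
    intro k g
    have : {c | pt k c = g} = (fun c => e k • c) ⁻¹' {x | pick x = g * (e k)⁻¹} := by
      ext c; simp [pt, eq_mul_inv_iff_mul_eq]
    rw [this]
    exact hBorel _ (hpickm _)
  let base : ℕ → X → Finset G := fun k c =>
    F.filter fun f => (f * e (k + 2)) • c ∈ (M ∪ R)ᶜ ∩ φ ⁻¹' {true}
  have hbm : ∀ k, MeasurableSet {c | Odd (base k c).card} := fun k =>
    measurableSet_filter_mem F _ (fun f => hBorel (f * e (k + 2))
      ((hM.union hR).compl.inter (hφ (measurableSet_singleton true)))) {B | Odd B.card}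
  let flip : ℕ → X → Prop := fun k c => ¬ (Odd (base k c).card ↔ code c k = true)
  have hflipm : ∀ k, MeasurableSet {c | flip k c} := by
    intro k
    have : {c | flip k c} = ({c | Odd (base k c).card} \ {c | code c k = true}) ∪
        ({c | code c k = true} \ {c | Odd (base k c).card}) := by
      ext c
      simp only [flip, mem_ofPred_eq, mem_union, mem_sdiff]
      tauto
    rw [this]
    exact ((hbm k).diff (hcode k)).union ((hcode k).diff (hbm k))
  let one : G → X → Prop := fun g c =>
    (∃ a : A, g = a ∧ P c a = some true) ∨ ∃ k < n, pt (k + 2) c = g ∧ flip k c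
  have honem : ∀ g, MeasurableSet {c | one g c} := by
    intro g
    have : {c | one g c} = (⋃ a : A, ⋃ _ : g = a, {c | P c a = some true}) ∪
        ⋃ k, ⋃ _ : k < n, {c | pt (k + 2) c = g} ∩ {c | flip k c} := by
      ext c; simp [one, and_left_comm]
    rw [this]
    exact (MeasurableSet.iUnion fun a => MeasurableSet.iUnion fun _ => hPm _ _).union
      (MeasurableSet.iUnion fun k => MeasurableSet.iUnion fun _ => (hptm _ _).inter (hflipm k))
  have honeW : ∀ g c, one g c → g ∈ W := by
    rintro g c (⟨a, rfl, -⟩ | ⟨k, hk, rfl, -⟩)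
    · exact hAW a.2
    · exact hptW _ (by omega) c
  let O : Set X := {z | ∃ g : G, g⁻¹ • z ∈ C ∧ one g (g⁻¹ • z)}
  have hO : ∀ c ∈ C, ∀ w ∈ W, w • c ∈ O ↔ one w c := by
    intro c hc w hw
    refine ⟨fun ⟨g, hg, hone⟩ => ?_, fun h => ⟨w, by simpa using hc, by simpa using h⟩⟩
    obtain ⟨rfl, -⟩ := hsep c hc _ hg w hw g (honeW _ _ hone) (by simp)
    simpa using hone
  let Q : ℕ → Set X := fun k => {z | ∃ g : G, g⁻¹ • z ∈ C ∧ pt k (g⁻¹ • z) = g}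
  have hQ : ∀ k z, z ∈ Q k ↔ ∃ c ∈ C, z = pt k c • c := by
    intro k z
    constructor
    · rintro ⟨g, hg, h⟩
      exact ⟨_, hg, by rw [h, smul_inv_smul]⟩
    · rintro ⟨c, hc, rfl⟩
      exact ⟨pt k c, by simpa using hc, by simp⟩
  have hQW : ∀ k < n + 2, ∀ c ∈ C, ∀ w ∈ W, w • c ∈ Q k → w = pt k c := by
    intro k hk c hc w hw h
    obtain ⟨c', hc', h⟩ := (hQ k _).1 h
    obtain ⟨h, rfl⟩ := hsep c hc c' hc' w hw _ (hptW k hk c') h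
    exact h
  have hQm : ∀ k, MeasurableSet (Q k) := fun k =>
    measurableSet_exists_inv_smul hBorel fun g => hC.inter (hptm k g)
  have hQM : ∀ k, Q k ⊆ M := by
    intro k z hz
    obtain ⟨c, -, rfl⟩ := (hQ k z).1 hz
    exact hptM k c
  have hOm : MeasurableSet O := measurableSet_exists_inv_smul hBorel fun g => hC.inter (honem g)
  let φ' : X → Bool := fun z => if z ∈ M then decide (z ∈ O) else φ z
  have hφ'M : ∀ z ∈ M, φ' z = true ↔ z ∈ O := fun z hz => by simp [φ', hz]
  have hφ'n : ∀ z, z ∉ M → φ' z = φ z := fun z hz => by simp [φ', hz]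
  have hφ'm : Measurable φ' :=
    Measurable.ite hM (measurable_to_bool (by
      have : (fun z => decide (z ∈ O)) ⁻¹' {true} = O := by ext; simp
      rwa [this])) hφ
  refine ⟨Q 1, Q 0, φ', hQm 1, hQm 0, hφ'm, ?_, hQM 1, hQM 0, ?_, hQ 0, hQ 1, ?_, ?_, ?_⟩
  · rw [Set.disjoint_left]
    intro z h1 h0
    obtain ⟨c, hc, rfl⟩ := (hQ 1 z).1 h1
    have := hQW 0 (by omega) c hc _ (hptW 1 (by omega) c) h0
    exact absurd (hptF 0 c _ (hpick _).1 1 this) one_ne_zero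
  · intro x hx
    exact hφ'n x fun h => hx (Or.inl h)
  · intro c hc a
    by_cases hR' : (a : G) • c ∈ R
    · have : (a : G) • c ∉ M := fun h => hMR.le_bot ⟨h, hR'⟩
      exact Or.inl ⟨hR', (hP c a).2 _ (by simp [knownData, this, hR'])⟩
    · refine Or.inr ⟨?_, ?_⟩
      · rintro ((h | h) | h)
        · exact hptA 1 c (hQW 1 (by omega) c hc _ (hAW a.2) h ▸ a.2)
        · exact hptA 0 c (hQW 0 (by omega) c hc _ (hAW a.2) h ▸ a.2)
        · exact hR' h
      · by_cases hM' : (a : G) • c ∈ M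
        · have h1 := (hP c a).1 (by simp [knownData, hM'])
          obtain ⟨v, hv⟩ := Option.ne_none_iff_exists'.1 h1
          rw [hv, Option.some_inj]
          have h2 : (a : G) • c ∈ O ↔ v = true := by
            rw [hO c hc _ (hAW a.2)]
            constructor
            · rintro (⟨a', ha', h⟩ | ⟨k, -, h, -⟩)
              · rw [← Subtype.ext ha', hv] at h
                simpa using h
              · exact absurd a.2 (h ▸ hptA _ c)
            · rintro rfl
              exact Or.inl ⟨a, rfl, hv⟩
          rw [Bool.eq_iff_iff, hφ'M _ hM', h2]
        · rw [hφ'n _ hM']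
          exact (hP c a).2 _ (by simp [knownData, hM', hR'])
  · rintro z hz (h | h)
    · have : z ∈ Q 1 ∨ z ∈ Q 0 := by
        by_contra! hcon
        exact h fun h' => h'.elim (fun h' => h'.elim hcon.1 hcon.2) fun h' => hMR.le_bot ⟨hz, h'⟩
      rcases this with h | h
      · obtain ⟨c, hc, h⟩ := (hQ _ z).1 h
        exact ⟨_, hptW 1 (by omega) c, c, hc, h⟩
      · obtain ⟨c, hc, h⟩ := (hQ _ z).1 h
        exact ⟨_, hptW 0 (by omega) c, c, hc, h⟩
    · obtain ⟨g, hg, hone⟩ := (hφ'M z hz).1 h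
      exact ⟨g, honeW _ _ hone, _, hg, by simp⟩
  · intro k hk c hc
    have hW : ∀ f ∈ F, f * e (k + 2) ∈ W := fun f hf => hFW f hf _ (by omega)
    refine ⟨fun f hf => ?_, ?_⟩
    · by_cases hR' : (f * e (k + 2)) • c ∈ R
      · exact Or.inl hR'
      · refine Or.inr ?_
        rintro ((h | h) | h)
        · have := hptF _ _ f hf _ (hQW 1 (by omega) c hc _ (hW f hf) h)
          omega
        · have := hptF _ _ f hf _ (hQW 0 (by omega) c hc _ (hW f hf) h)
          omega
        · exact hR' h
    · set f₀ := pick (e (k + 2) • c) with hf₀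
      have hf₀F : f₀ ∈ F := (hpick _).1
      have hf₀M : (f₀ * e (k + 2)) • c ∈ M := hptM (k + 2) c
      have hone : ∀ f ∈ F, one (f * e (k + 2)) c ↔ f = f₀ ∧ flip k c := by
        intro f hf
        constructor
        · rintro (⟨a, h, -⟩ | ⟨k', -, h, hfl⟩)
          · exact absurd (h ▸ a.2) (heA f hf _)
          · obtain rfl : k = k' := by
              have := hptF _ _ f hf _ h.symm
              omega
            exact ⟨mul_right_cancel h.symm, hfl⟩
        · rintro ⟨rfl, h⟩
          exact Or.inr ⟨k, hk, rfl, h⟩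
      have hmem : ∀ f ∈ F, (f * e (k + 2)) • c ∈ Rᶜ ∩ φ' ⁻¹' {true} ↔
          f ∈ base k c ∨ (f = f₀ ∧ flip k c) := by
        intro f hf
        by_cases hfM : (f * e (k + 2)) • c ∈ M
        · have h1 : (f * e (k + 2)) • c ∉ R := fun h => hMR.le_bot ⟨hfM, h⟩
          rw [← hone f hf, ← hO c hc _ (hW f hf), ← hφ'M _ hfM]
          simp [base, hfM, h1]
        · have h1 : f ≠ f₀ := by
            rintro rfl
            exact hfM hf₀M
          simp [base, hfM, h1, hf, hφ'n]
      have hf₀b : f₀ ∉ base k c := fun h => (Finset.mem_filter.1 h).2.1 (Or.inl hf₀M)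
      by_cases hfl : flip k c
      · have : (F.filter fun f => (f * e (k + 2)) • c ∈ Rᶜ ∩ φ' ⁻¹' {true}) =
            insert f₀ (base k c) := by
          ext f
          rw [Finset.mem_filter, Finset.mem_insert]
          constructor
          · rintro ⟨hf, h⟩
            exact ((hmem f hf).1 h).symm.imp And.left id
          · rintro (rfl | h)
            · exact ⟨hf₀F, (hmem _ hf₀F).2 (Or.inr ⟨rfl, hfl⟩)⟩
            · have hf := (Finset.mem_filter.1 h).1
              exact ⟨hf, (hmem f hf).2 (Or.inl h)⟩
        rw [this, Finset.card_insert_of_notMem hf₀b, Nat.odd_add_one]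
        simp only [flip] at hfl
        tauto
      · have : (F.filter fun f => (f * e (k + 2)) • c ∈ Rᶜ ∩ φ' ⁻¹' {true}) = base k c := by
          ext f
          rw [Finset.mem_filter]
          constructor
          · rintro ⟨hf, h⟩
            exact ((hmem f hf).1 h).resolve_right fun h => hfl h.2
          · intro h
            have hf := (Finset.mem_filter.1 h).1
            exact ⟨hf, (hmem f hf).2 (Or.inl h)⟩
        rw [this]
        simp only [flip, not_not] at hfl
        exact hfl.symm

end Construction

section Recognition

variable {G X : Type*} [Group G] [MulAction G X]

theorem agree_of_not_exists {dom : Set X} {φ : X → Bool} [DecidableEq G] {T : Finset G} {x y : X}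
    (h : ¬ ∃ t ∈ T.image (·⁻¹), t⁻¹ • x ∈ dom ∧ t⁻¹ • y ∈ dom ∧ φ (t⁻¹ • x) ≠ φ (t⁻¹ • y)) :
    Agree dom φ T x y := by
  intro t ht hx hy
  by_contra hne
  exact h ⟨t⁻¹, Finset.mem_image_of_mem _ ht, by simpa using ⟨hx, hy, hne⟩⟩

theorem Recognizable.exists_agree {dom dom' : Set X} {φ φ' : X → Bool} {R : Set X}
    (h : Recognizable (G := G) dom φ R) (hdom : dom ⊆ dom') (hφ : ∀ x ∈ dom, φ' x = φ x) :
    ∃ T : Finset G, ∀ x y, Agree dom' φ' T x y → (x ∈ R ↔ y ∈ R) := by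
  classical
  obtain ⟨T, hT⟩ := h
  have key : ∀ x y, Agree dom' φ' (T.image (·⁻¹)) x y → x ∈ R → y ∈ R := by
    intro x y hxy hx
    by_contra hy
    obtain ⟨t, ht, h1, h2, h3⟩ := hT x hx y hy
    refine h3 ?_
    rw [← hφ _ h1, ← hφ _ h2]
    exact hxy _ (Finset.mem_image_of_mem _ ht) (hdom h1) (hdom h2)
  exact ⟨_, fun x y hxy => ⟨key x y hxy, key y x hxy.symm⟩⟩

/-- The pattern `p` distinguishes every nontrivial translation in `H`. -/
def Aperiodic (A H : Finset G) (p : A → Option Bool) : Prop :=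
  ∀ h ∈ H, h ≠ 1 → ∃ a a' : A, (a' : G) = a * h ∧ p a ≠ p a'

/-- Points which are not distinguished from a point `x ∈ C` by the traces along a suitable finite
set have a pattern of at least the same rank, and in the case of equality they are `H`-close to
a point of `C`. -/
theorem exists_agree_rank_le (hfree : ∀ (g : G) (x : X), g • x = x → g = 1)
    {M R : Set X} (hMR : Disjoint M R) {φ φ' : X → Bool} {dom : Set X}
    (hdom : (M ∪ R)ᶜ ⊆ dom) (hdomR : dom ⊆ Rᶜ)
    (hφ : ∀ x ∈ (M ∪ R)ᶜ, φ' x = φ x) {T : Finset G}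
    (hT : ∀ x y, Agree dom φ' T x y → (x ∈ R ↔ y ∈ R))
    {F A A₁ W H : Finset G} {b : Fin 3 → G} (hF : ∀ x : X, ∃ f ∈ F, f • x ∈ M)
    (hFb : ∀ f ∈ F, ∀ i, f * b i ∈ A₁) (hA₁ : A₁ ⊆ A)
    (hcore : ∀ g, (∀ i, ∃ f ∈ F, f * b i * g ∈ W) → g ∈ H)
    {C : Set X} (hsep : ∀ c ∈ C, ∀ c' ∈ C, ∀ a ∈ A₁, ∀ a' ∈ A₁, ∀ w ∈ W, ∀ w' ∈ W,
      (a⁻¹ * w) • c = (a'⁻¹ * w') • c' → c = c')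
    {P : X → A → Option Bool} {val : (A → Option Bool) → ℕ} (hval : val.Injective)
    (hmax : ∀ x p, Fills (knownData M R φ A x) p → val p ≤ val (P x))
    (hP : ∀ x, Aperiodic A H (P x))
    (hPcore : ∀ x, ∀ a : A, (a : G) ∈ A₁ → (a : G) • x ∈ M → P x a = some true)
    (hPφ : ∀ c ∈ C, ∀ a : A, ((a : G) • c ∈ R ∧ P c a = none) ∨
      ((a : G) • c ∈ dom ∧ P c a = some (φ' ((a : G) • c))))
    (hW : ∀ z ∈ M, z ∉ dom ∨ φ' z = true → ∃ w ∈ W, ∃ c ∈ C, z = w • c) :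
    ∃ T₁ : Finset G, ∀ x ∈ C, ∀ y, Agree dom φ' T₁ x y → val (P x) ≤ val (P y) ∧
      (val (P x) = val (P y) → ∃ g ∈ H, ∃ r ∈ C, y = g • r ∧ (val (P r) = val (P x) → y = r)) := by
  classical
  refine ⟨A ∪ A.biUnion fun a => T.image (· * a), fun x hx y hxy => ?_⟩
  have hxyA : ∀ a ∈ A, a • x ∈ dom → a • y ∈ dom → φ' (a • x) = φ' (a • y) := fun a ha =>
    hxy a (Finset.mem_union_left _ ha)
  have hxyR : ∀ a ∈ A, a • x ∈ R ↔ a • y ∈ R := fun a ha =>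
    hT _ _ (hxy.smul fun t ht => Finset.mem_union_right _
      (Finset.mem_biUnion.2 ⟨a, ha, Finset.mem_image_of_mem _ ht⟩))
  have hfill : Fills (knownData M R φ A y) (P x) := by
    intro a
    have hR := hxyR a a.2
    rcases hPφ x hx a with ⟨h1, h2⟩ | ⟨h1, h2⟩
    · have h3 : (a : G) • y ∈ R := hR.1 h1
      have h4 : (a : G) • y ∉ M := fun h => hMR.le_bot ⟨h, h3⟩
      simp [knownData, h3, h4, h2]
    · have h3 : (a : G) • y ∉ R := fun h => hdomR h1 (hR.2 h)
      by_cases h4 : (a : G) • y ∈ M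
      · simp [knownData, h4, h2]
      · have h5 : (a : G) • y ∈ (M ∪ R)ᶜ := fun h => h.elim h4 h3
        simp [knownData, h3, h4, h2, ← hφ _ h5, hxyA a a.2 h1 (hdom h5)]
  refine ⟨hmax y _ hfill, fun heq => ?_⟩
  have hPxy : P x = P y := hval heq
  have hstar : ∀ i, ∃ f ∈ F, ∃ w ∈ W, ∃ r ∈ C, (f * b i) • y = w • r := by
    intro i
    obtain ⟨f, hf, hfM⟩ := hF (b i • y)
    rw [← mul_smul] at hfM
    have ha := hA₁ (hFb f hf i)
    refine ⟨f, hf, hW _ hfM ?_⟩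
    have h1 : P x ⟨f * b i, ha⟩ = some true := by
      rw [hPxy]
      exact hPcore y _ (hFb f hf i) hfM
    rcases hPφ x hx ⟨f * b i, ha⟩ with ⟨-, h2⟩ | ⟨h2, h3⟩
    · rw [h2] at h1
      simp at h1
    · rw [h1, Option.some_inj] at h3
      by_cases h4 : (f * b i) • y ∈ dom
      · exact Or.inr ((hxyA _ ha h2 h4).symm.trans h3.symm)
      · exact Or.inl h4
  choose f hf w hw r hr hwr using hstar
  have hyr : ∀ i, y = ((f i * b i)⁻¹ * w i) • r i := fun i => by
    rw [mul_smul, ← hwr, inv_smul_smul]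
  have hrr : ∀ i, r i = r 0 := fun i =>
    hsep _ (hr i) _ (hr 0) _ (hFb _ (hf i) i) _ (hFb _ (hf 0) 0) _ (hw i) _ (hw 0)
      ((hyr i).symm.trans (hyr 0))
  set g := (f 0 * b 0)⁻¹ * w 0 with hg
  have hgH : g ∈ H := by
    refine hcore g fun i => ⟨f i, hf i, ?_⟩
    have h1 : (w i)⁻¹ * (f i * b i * g) = 1 := by
      refine hfree _ (r 0) ?_
      rw [mul_smul, mul_smul, hg, ← hyr 0, hwr i, hrr i, inv_smul_smul]
    rw [inv_mul_eq_one] at h1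
    rw [← h1]
    exact hw i
  refine ⟨g, hgH, r 0, hr 0, hyr 0, fun hq => ?_⟩
  by_contra hne
  have hg1 : g ≠ 1 := fun h => hne (by rw [hyr 0, ← hg, h, one_smul])
  have hPr : P (r 0) = P x := hval hq
  obtain ⟨a, a', haa, hPa⟩ := hP (r 0) g hgH hg1
  have hay : (a : G) • y = (a' : G) • r 0 := by rw [haa, mul_smul, hg, ← hyr 0]
  refine hPa ?_
  rw [hPr]
  rcases hPφ x hx a with ⟨h1, h2⟩ | ⟨h1, h2⟩
  · have h3 : (a' : G) • r 0 ∈ R := hay ▸ (hxyR a a.2).1 h1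
    rcases hPφ _ (hr 0) a' with ⟨-, h4⟩ | ⟨h4, -⟩
    · rw [h2, ← hPr, h4]
    · exact absurd h3 (hdomR h4)
  · have h3 : (a' : G) • r 0 ∉ R := fun h => hdomR h1 ((hxyR a a.2).2 (hay ▸ h))
    rcases hPφ _ (hr 0) a' with ⟨h4, -⟩ | ⟨h4, h5⟩
    · exact absurd h4 h3
    · rw [hPr] at h5
      rw [h2, h5, ← hay]
      exact congrArg some (hxyA a a.2 h1 (hay ▸ h4))

end Recognition

section Scales

open scoped Pointwise

variable {G : Type*} [Group G]

/-- A decreasing sequence of symmetric finite sets containing `B` which absorbs `H`. -/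
theorem exists_scales (N : ℕ) (H : Finset G) (h1 : 1 ∈ H) (hH : ∀ h ∈ H, h⁻¹ ∈ H)
    [DecidableEq G] (B : Finset G) (hB1 : 1 ∈ B) (hB : ∀ g ∈ B, g⁻¹ ∈ B) :
    ∃ S : ℕ → Finset G, (∀ v, ∀ g ∈ S v, g⁻¹ ∈ S v) ∧ (∀ v, B ⊆ S v) ∧
      (∀ v, v < N → H ⊆ S v) ∧
      (∀ u v, u < v → v < N → ∀ g ∈ S v, ∀ h ∈ H, g * h ∈ S u) ∧
      (∀ u v, u ≤ v → v < N → S v ⊆ S u) ∧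
      (S 0).card ≤ (H ^ N).card ^ 2 * B.card := by
  have hHm : ∀ {m k}, m ≤ k → H ^ m ⊆ H ^ k := fun h => Finset.pow_subset_pow_right h1 h
  have hone : ∀ m, (1 : G) ∈ H ^ m := fun m => Finset.one_mem_pow h1
  have hHinv : H⁻¹ = H := by
    ext g
    rw [Finset.mem_inv']
    exact ⟨fun h => by simpa using hH _ h, hH g⟩
  have hBinv : B⁻¹ = B := by
    ext g
    rw [Finset.mem_inv']
    exact ⟨fun h => by simpa using hB _ h, hB g⟩
  refine ⟨fun v => H ^ (N - v) * B * H ^ (N - v), fun v g hg => ?_, fun v g hg => ?_,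
    fun v hv g hg => ?_, fun u v huv hv g hg h hh => ?_, fun u v huv hv => ?_, ?_⟩
  · rw [← Finset.mem_inv']
    rwa [mul_inv_rev, mul_inv_rev, ← inv_pow, hHinv, hBinv, ← mul_assoc]
  · simpa using Finset.mul_mem_mul (Finset.mul_mem_mul (hone (N - v)) hg) (hone (N - v))
  · have : g ∈ H ^ (N - v) := hHm (show 1 ≤ N - v by omega) (by simpa using hg)
    simpa using Finset.mul_mem_mul (Finset.mul_mem_mul (hone (N - v)) hB1) this
  · have h2 := Finset.mul_mem_mul hg hh
    rw [mul_assoc, ← pow_succ] at h2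
    exact Finset.mul_subset_mul (Finset.mul_subset_mul_right (hHm (by omega))) (hHm (by omega)) h2
  · exact Finset.mul_subset_mul (Finset.mul_subset_mul_right (hHm (by omega))) (hHm (by omega))
  · calc (H ^ (N - 0) * B * H ^ (N - 0)).card
        ≤ (H ^ N * B).card * (H ^ N).card := Finset.card_mul_le
      _ ≤ ((H ^ N).card * B.card) * (H ^ N).card := Nat.mul_le_mul_right _ Finset.card_mul_le
      _ = _ := by ring

end Scales

section Assembly

variable {G X : Type*} [Group G] [MulAction G X]

/-- A choice of patterns filling in the known data, maximal for some ranking, which are aperiodic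
and take the value `true` at all undetermined core positions. -/
theorem exists_aperiodic_patterns (M R : Set X) (φ : X → Bool)
    {F A A₁ H : Finset G} {t : H → G} (hF : ∀ x : X, ∃ f ∈ F, f • x ∈ M)
    (htA : ∀ h : H, ∀ f ∈ F, f * t h ∈ A ∧ f * t h * h ∈ A)
    (htA₁ : ∀ h : H, ∀ f ∈ F, f * t h ∉ A₁)
    (htt : ∀ f ∈ F, ∀ f' ∈ F, ∀ h h' : H, f * t h = f' * t h' → h = h')
    (htt' : ∀ f ∈ F, ∀ f' ∈ F, ∀ h h' : H, f * t h * h = f' * t h' → h = h') :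
    ∃ (val : (A → Option Bool) → ℕ) (best : (A → Option (Option Bool)) → A → Option Bool),
      val.Injective ∧ ∀ x, Fills (knownData M R φ A x) (best (knownData M R φ A x)) ∧
        (∀ p, Fills (knownData M R φ A x) p → val p ≤ val (best (knownData M R φ A x))) ∧
        Aperiodic A H (best (knownData M R φ A x)) ∧
        ∀ a : A, (a : G) ∈ A₁ → (a : G) • x ∈ M →
          best (knownData M R φ A x) a = some true := by
  classical
  obtain ⟨val, best, hval, hbest⟩ := exists_ranking (A₁.subtype (· ∈ A)) {p | Aperiodic A H p}
  refine ⟨val, best, hval, fun x => ?_⟩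
  obtain ⟨hfill, hmax, hgood⟩ := hbest (knownData M R φ A x)
  have hknown : ∀ a : A, (a : G) • x ∈ M → knownData M R φ A x a = none := fun a ha => by
    simp [knownData, ha]
  choose f hfF hfM using fun h : H => hF (t h • x)
  obtain ⟨p, hp, hne, hcore⟩ := exists_fills_ne (knownData M R φ A x) (A₁.subtype (· ∈ A))
    (fun h : {h : H // (h : G) ≠ 1} => ⟨f h * t h, (htA h _ (hfF h)).1⟩)
    (fun h => ⟨f h * t h * h, (htA h _ (hfF h)).2⟩)
    (fun h h' heq => Subtype.ext (htt _ (hfF _) _ (hfF _) _ _ (congrArg Subtype.val heq)))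
    (fun h h' heq => by
      have heq := congrArg Subtype.val heq
      have h1 : h = h' := Subtype.ext (htt' _ (hfF _) _ (hfF _) _ _ heq)
      rw [h1] at heq
      exact h'.2 (mul_eq_left.1 heq))
    (fun h hmem => htA₁ _ _ (hfF _) (Finset.mem_subtype.1 hmem))
    (fun h => hknown _ (by simpa only [mul_smul] using hfM h))
  obtain ⟨h1, h2⟩ := hgood ⟨p, hp, fun h hh h1 => ⟨_, _, rfl, hne ⟨⟨h, hh⟩, h1⟩⟩, hcore⟩
  exact ⟨hfill, hmax, h1, fun a ha haM => h2 a (Finset.mem_subtype.2 ha) (hknown a haM)⟩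

end Assembly

section Code

variable {G X : Type*} [Group G] [MeasurableSpace X] [MulAction G X]

/-- A Borel binary code which determines `pick` and separates `x` from its translates by conjugates
of `s` by elements of `S`. -/
theorem exists_measurable_code [StandardBorelSpace X]
    (hBorel : ∀ g : G, Measurable fun x : X => g • x)
    (hfree : ∀ (g : G) (x : X), g • x = x → g = 1) (S F : Finset G) {s : G} (hs : s ≠ 1)
    {pick : X → G} (hpick : ∀ x, pick x ∈ F) (hpickm : ∀ g, MeasurableSet {x | pick x = g})
    {n : ℕ} (hn : (2 * S.card + 1) * F.card ≤ 2 ^ n) :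
    ∃ code : X → ℕ → Bool, (∀ k, MeasurableSet {x | code x k = true}) ∧
      ∀ x y, (∀ k < n, code x k = code y k) → pick x = pick y ∧
        ∀ g ∈ S, y ≠ (g * s * g⁻¹) • x := by
  classical
  set T := S.image (fun g => g * s * g⁻¹) ∪ S.image (fun g => g * s⁻¹ * g⁻¹) with hT
  have hTcard : T.card ≤ 2 * S.card := by
    refine (Finset.card_union_le _ _).trans ?_
    have h1 := Finset.card_image_le (s := S) (f := fun g => g * s * g⁻¹)
    have h2 := Finset.card_image_le (s := S) (f := fun g => g * s⁻¹ * g⁻¹)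
    omega
  obtain ⟨col, hcol, hcolT⟩ := exists_measurable_coloring hBorel hfree T (by
    intro t ht
    simp only [hT, Finset.mem_union, Finset.mem_image] at ht ⊢
    rcases ht with ⟨g, hg, rfl⟩ | ⟨g, hg, rfl⟩
    · exact Or.inr ⟨g, hg, by group⟩
    · exact Or.inl ⟨g, hg, by group⟩)
  obtain ⟨enc⟩ : Nonempty (Fin (T.card + 1) × F ↪ (Fin n → Bool)) := by
    refine Function.Embedding.nonempty_of_card_le ?_
    simp only [Fintype.card_prod, Fintype.card_fin, Fintype.card_coe, Fintype.card_pi,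
      Fintype.card_bool, Finset.prod_const, Finset.card_univ]
    exact (Nat.mul_le_mul_right _ (by omega)).trans hn
  let w : X → Fin (T.card + 1) × F := fun x => (col x, ⟨pick x, hpick x⟩)
  have hw : ∀ s : Set (Fin (T.card + 1) × F), MeasurableSet {x | w x ∈ s} := by
    intro s
    have : {x | w x ∈ s} = ⋃ p ∈ s, col ⁻¹' {p.1} ∩ {x | pick x = p.2} := by
      ext x
      simp only [mem_ofPred_eq, mem_iUnion, mem_inter_iff, mem_preimage, mem_singleton_iff,
        exists_prop]
      refine ⟨fun h => ⟨_, h, rfl, rfl⟩, fun ⟨p, hp, h1, h2⟩ => ?_⟩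
      have : w x = p := Prod.ext h1 (Subtype.ext h2)
      rwa [this]
    rw [this]
    exact (Set.toFinite s).measurableSet_biUnion fun p _ =>
      (hcol (measurableSet_singleton _)).inter (hpickm _)
  refine ⟨fun x k => if h : k < n then enc (w x) ⟨k, h⟩ else false, fun k => ?_, fun x y h => ?_⟩
  · by_cases hk : k < n
    · simp only [hk, dif_pos]
      exact hw {p | enc p ⟨k, hk⟩ = true}
    · simp [hk]
  · have hxy : w x = w y := enc.injective <| funext fun k => by simpa using h k k.2
    refine ⟨congrArg (fun p => (p.2 : G)) hxy, fun g hg hy => ?_⟩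
    refine hcolT x (g * s * g⁻¹) ?_ ?_ ?_
    · exact Finset.mem_union_left _ (Finset.mem_image_of_mem (fun g => g * s * g⁻¹) hg)
    · simpa using hs
    · rw [← hy]
      exact (congrArg Prod.fst hxy).symm

end Code

/-- Lemma 4.2 (the inductive step): given disjoint Borel sets `M, R ⊆ X` with `M` syndetic,
a Borel function `φ` defined off `M ∪ R` recognizing `R`, and `s ≠ 1` in `G`, there are
Borel sets `M', R' ⊆ M` and a Borel extension `φ'` of `φ` defined off `M' ∪ R' ∪ R` such
that `M'` and `R'` are disjoint and syndetic, `R'` is `φ'`-recognizable, and for some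
finite `T ⊆ G` the partial functions `φ̃'(x)↾T` and `φ̃'(s • x)↾T` are incompatible for
every `x ∈ X`. -/
theorem inductive_step
    {G : Type*} [Group G] [Countable G] [Infinite G]
    {X : Type*} [MeasurableSpace X] [StandardBorelSpace X] [MulAction G X]
    (hBorel : ∀ g : G, Measurable fun x : X => g • x)
    (hfree : ∀ (g : G) (x : X), g • x = x → g = 1)
    (M R : Set X) (hM : MeasurableSet M) (hR : MeasurableSet R)
    (hMR : Disjoint M R) (hMsynd : Syndetic (G := G) M)
    (φ : X → Bool) (hφ : Measurable φ)
    (hrec : Recognizable (G := G) ((M ∪ R)ᶜ) φ R)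
    (s : G) (hs : s ≠ 1) :
    ∃ (M' R' : Set X) (φ' : X → Bool),
      MeasurableSet M' ∧ MeasurableSet R' ∧ Measurable φ' ∧
      -- (i) `M'` and `R'` are disjoint subsets of `M`
      Disjoint M' R' ∧ M' ⊆ M ∧ R' ⊆ M ∧
      -- (ii) `φ'` extends `φ`
      (∀ x ∈ (M ∪ R)ᶜ, φ' x = φ x) ∧
      -- (iii) `M'` and `R'` are syndetic and `R'` is `φ'`-recognizable
      Syndetic (G := G) M' ∧ Syndetic (G := G) R' ∧
      Recognizable (G := G) ((M' ∪ R' ∪ R)ᶜ) φ' R' ∧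
      -- (iv) a finite `T` witnessing incompatibility of `φ̃'(x)↾T` and `φ̃'(s•x)↾T`
      ∃ T : Finset G, ∀ x : X, ∃ t ∈ T,
        t⁻¹ • x ∈ (M' ∪ R' ∪ R)ᶜ ∧ t⁻¹ • (s • x) ∈ (M' ∪ R' ∪ R)ᶜ ∧
        φ' (t⁻¹ • x) ≠ φ' (t⁻¹ • (s • x)) := by
  classical
  open scoped Pointwise in
  obtain ⟨F, hF1, hF⟩ : ∃ F : Finset G, 1 ∈ F ∧ ∀ x : X, ∃ f ∈ F, f • x ∈ M := by
    obtain ⟨F, hF⟩ := hMsynd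
    refine ⟨insert 1 (F.image (·⁻¹)), Finset.mem_insert_self _ _, fun x => ?_⟩
    obtain ⟨g, hg, hgx⟩ := hF x
    exact ⟨g⁻¹, Finset.mem_insert_of_mem (Finset.mem_image_of_mem _ hg), hgx⟩
  obtain ⟨b, d, A₁, H, hFb, hH1, hHinv, hdd, hdA₁, hcore⟩ := exists_core_and_blocks F hF1
  have hb0 : b 0 ∈ A₁ := by simpa using hFb 1 hF1 0
  have hdd1 : ∀ f ∈ F, ∀ f' ∈ F, ∀ j j', f * d j = f' * d j' → j = j' :=
    fun f hf f' hf' j j' h => hdd f hf f' hf' j j' 1 hH1 1 hH1 (by simpa using h)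
  have hddσ : ∀ f ∈ F, ∀ f' ∈ F, ∀ j j', ∀ σ ∈ H, f * d j * σ = f' * d j' → j = j' :=
    fun f hf f' hf' j j' σ hσ h => hdd f hf f' hf' j j' σ hσ 1 hH1 (by simpa using h)
  have hdA₁1 : ∀ f ∈ F, ∀ j, f * d j ∉ A₁ := fun f hf j => by simpa using hdA₁ f hf j 1 hH1
  -- the window carrying the patterns
  let A : Finset G := A₁ ∪ H.biUnion fun h =>
    F.image (fun f => f * d (Sum.inl h)) ∪ F.image (fun f => f * d (Sum.inl h) * h)
  have hA : ∀ a, a ∈ A ↔ a ∈ A₁ ∨ ∃ h ∈ H, ∃ f ∈ F,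
      a = f * d (Sum.inl h) ∨ a = f * d (Sum.inl h) * h := by
    intro a
    simp only [A, Finset.mem_union, Finset.mem_biUnion, Finset.mem_image]
    refine or_congr_right (exists_congr fun h => and_congr_right fun _ => ?_)
    constructor
    · rintro (⟨f, hf, rfl⟩ | ⟨f, hf, rfl⟩)
      exacts [⟨f, hf, Or.inl rfl⟩, ⟨f, hf, Or.inr rfl⟩]
    · rintro ⟨f, hf, rfl | rfl⟩
      exacts [Or.inl ⟨f, hf, rfl⟩, Or.inr ⟨f, hf, rfl⟩]
  have hA₁A : A₁ ⊆ A := Finset.subset_union_left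
  let e : ℕ → G := fun k => d (Sum.inr k)
  have heA : ∀ f ∈ F, ∀ k, f * e k ∉ A := by
    intro f hf k hmem
    rcases (hA _).1 hmem with h | ⟨h, hh, f', hf', heq | heq⟩
    · exact hdA₁1 f hf _ h
    · simpa using hdd1 f hf f' hf' _ _ heq
    · simpa using hddσ f' hf' f hf _ _ h hh heq.symm
  have hee : ∀ f ∈ F, ∀ f' ∈ F, ∀ k k', f * e k = f' * e k' → k = k' :=
    fun f hf f' hf' k k' h => by simpa using hdd1 f hf f' hf' _ _ h
  -- the patterns and their ranking
  obtain ⟨val, best, hval, hbest⟩ := exists_aperiodic_patterns M R φ (F := F) (A := A) (A₁ := A₁)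
    (H := H) (t := fun h => d (Sum.inl (h : G))) hF
    (fun h f hf => ⟨(hA _).2 (Or.inr ⟨h, h.2, f, hf, Or.inl rfl⟩),
      (hA _).2 (Or.inr ⟨h, h.2, f, hf, Or.inr rfl⟩)⟩)
    (fun h f hf => hdA₁1 f hf _)
    (fun f hf f' hf' h h' heq => Subtype.ext (by simpa using hdd1 f hf f' hf' _ _ heq))
    (fun f hf f' hf' h h' heq => Subtype.ext (by simpa using hddσ f hf f' hf' _ _ h h.2 heq))
  let P : X → A → Option Bool := fun x => best (knownData M R φ A x)
  have hPm : ∀ s : Set (A → Option Bool), MeasurableSet {x | P x ∈ s} := fun s =>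
    measurableSet_knownData hBorel hM hR hφ A (best ⁻¹' s)
  let q : X → ℕ := fun x => val (P x)
  have hqm : Measurable q := measurable_to_countable' fun k => hPm (val ⁻¹' {k})
  obtain ⟨N, hN⟩ : ∃ N, ∀ p, val p < N :=
    ⟨Finset.univ.sup val + 1, fun p => Nat.lt_succ_of_le (Finset.le_sup (Finset.mem_univ p))⟩
  -- the number of code blocks, and the separation scales
  obtain ⟨n, hn⟩ := exists_mul_sq_le_two_pow
    (3 * F.card * (H ^ N).card ^ 2 * A₁.card ^ 2 * (A.card + F.card) ^ 2)
  let W : Finset G := A ∪ F * (Finset.range (n + 2)).image e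
  have hAW : A ⊆ W := Finset.subset_union_left
  have hFW : ∀ f ∈ F, ∀ k < n + 2, f * e k ∈ W := fun f hf k hk =>
    Finset.mem_union_right _ (Finset.mul_mem_mul hf
      (Finset.mem_image_of_mem _ (Finset.mem_range.2 hk)))
  have hWcard : W.card ≤ (A.card + F.card) * (n + 2) := by
    have h1 : (F * (Finset.range (n + 2)).image e).card ≤ F.card * (n + 2) :=
      Finset.card_mul_le.trans (Nat.mul_le_mul_left _ (by
        simpa using Finset.card_image_le (s := Finset.range (n + 2)) (f := e)))
    have h2 := Finset.card_union_le A (F * (Finset.range (n + 2)).image e)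
    nlinarith
  have hcoreW : ∀ g, (∀ i, ∃ f ∈ F, f * b i * g ∈ W) → g ∈ H := by
    intro g hg
    refine hcore (Sum.elim (fun h => if h ∈ H then h else 1) fun _ => 1) ?_ g fun i => ?_
    · rintro (h | k)
      · by_cases hh : h ∈ H <;> simp [hh, hH1]
      · simpa using hH1
    · obtain ⟨f, hf, hmem⟩ := hg i
      refine ⟨f, hf, ?_⟩
      rcases Finset.mem_union.1 hmem with h | h
      · rcases (hA _).1 h with h | ⟨h, hh, f', hf', heq | heq⟩
        · exact Or.inl h
        · exact Or.inr ⟨_, f', hf', Or.inl heq⟩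
        · exact Or.inr ⟨Sum.inl h, f', hf', Or.inr (by simpa [hh] using heq)⟩
      · obtain ⟨f', hf', y, hy, heq⟩ := Finset.mem_mul.1 h
        obtain ⟨k, -, rfl⟩ := Finset.mem_image.1 hy
        exact Or.inr ⟨Sum.inr k, f', hf', Or.inl heq.symm⟩
  let V : Finset G := A₁⁻¹ * W
  have hV : ∀ a ∈ A₁, ∀ w ∈ W, a⁻¹ * w ∈ V := fun a ha w hw =>
    Finset.mul_mem_mul (Finset.inv_mem_inv ha) hw
  have hV1 : 1 ∈ V := by simpa using hV _ hb0 _ (hAW (hA₁A hb0))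
  obtain ⟨S, hSinv, hVS, hHS, hSH, hSanti, hScard⟩ := exists_scales N H hH1 hHinv (V⁻¹ * V)
    (by simpa using Finset.mul_mem_mul (Finset.inv_mem_inv hV1) hV1)
    (fun g hg => by rw [← Finset.mem_inv']; rwa [mul_inv_rev, inv_inv])
  have hVV : ∀ v ∈ V, ∀ v' ∈ V, ∀ k, v'⁻¹ * v ∈ S k := fun v hv v' hv' k =>
    hVS k (Finset.mul_mem_mul (Finset.inv_mem_inv hv') hv)
  have hS1 : ∀ k, 1 ∈ S k := fun k => by simpa using hVV 1 hV1 1 hV1 k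
  obtain ⟨C, hC, hCsep, hCcov⟩ := exists_greedy_separated hBorel hfree hqm (fun x => hN (P x))
    S hSinv hS1
  have hsepV : ∀ c ∈ C, ∀ c' ∈ C, ∀ v ∈ V, ∀ v' ∈ V, v • c = v' • c' → c = c' := by
    have key : ∀ c ∈ C, ∀ c' ∈ C, ∀ v ∈ V, ∀ v' ∈ V, q c ≤ q c' → v • c = v' • c' → c = c' := by
      intro c hc c' hc' v hv v' hv' hq h
      have h1 : (v'⁻¹ * v) • c = c' := by rw [mul_smul, h, inv_smul_smul]
      have h2 := hCsep c hc _ (hVV v hv v' hv' _) (h1 ▸ hc') (h1 ▸ hq)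
      rwa [h2, one_smul] at h1
    intro c hc c' hc' v hv v' hv' h
    rcases le_total (q c) (q c') with hq | hq
    · exact key c hc c' hc' v hv v' hv' hq h
    · exact (key c' hc' c hc v' hv' v hv hq h.symm).symm
  have hsepW : ∀ c ∈ C, ∀ c' ∈ C, ∀ w ∈ W, ∀ w' ∈ W, w • c = w' • c' → w = w' ∧ c = c' := by
    intro c hc c' hc' w hw w' hw' h
    obtain rfl : c = c' := hsepV c hc c' hc' _ (hV _ hb0 w hw) _ (hV _ hb0 w' hw') (by
      rw [mul_smul, h, ← mul_smul])
    refine ⟨?_, rfl⟩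
    have h1 := hfree (w'⁻¹ * w) c (by rw [mul_smul, h, inv_smul_smul])
    exact (inv_mul_eq_one.1 h1).symm
  have hCsynd : ∀ x, ∃ g ∈ S 0, g • x ∈ C := fun x => by
    obtain ⟨g, hg, hgx, -⟩ := hCcov x
    exact ⟨g, hSanti 0 _ (Nat.zero_le _) (hN _) hg, hgx⟩
  -- the code
  obtain ⟨pick, hpick, hpickm⟩ := exists_measurable_pick hBorel hM F hF
  obtain ⟨code, hcode, hcodeinj⟩ := exists_measurable_code hBorel hfree (S 0) F hs
    (pick := fun x => pick (e 0 • x)) (fun x => (hpick _).1) (fun g => hBorel (e 0) (hpickm g))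
    (n := n) (by
      have h1 : 1 ≤ (S 0).card := Finset.card_pos.2 ⟨1, hS1 0⟩
      have h2 : V.card ≤ A₁.card * W.card := by
        simpa using Finset.card_mul_le (s := A₁⁻¹) (t := W)
      have h3 : (V⁻¹ * V).card ≤ V.card * V.card := by
        simpa using Finset.card_mul_le (s := V⁻¹) (t := V)
      calc (2 * (S 0).card + 1) * F.card ≤ (3 * (S 0).card) * F.card :=
            Nat.mul_le_mul_right _ (by omega)
        _ ≤ (3 * ((H ^ N).card ^ 2 * (V.card * V.card))) * F.card := by
            have h4 := hScard.trans (Nat.mul_le_mul_left _ h3)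
            gcongr
        _ ≤ (3 * ((H ^ N).card ^ 2 * ((A₁.card * ((A.card + F.card) * (n + 2))) *
              (A₁.card * ((A.card + F.card) * (n + 2)))))) * F.card := by
            have h4 := h2.trans (Nat.mul_le_mul_left _ hWcard)
            gcongr
        _ = 3 * F.card * (H ^ N).card ^ 2 * A₁.card ^ 2 * (A.card + F.card) ^ 2 * (n + 2) ^ 2 := by
            ring
        _ ≤ 2 ^ n := hn)
  obtain ⟨M', R', φ', hM', hR', hφ', hMR', hM'M, hR'M, hext, hmemR', hmemM', hPφ, hφW, hbits⟩ :=
    exists_extension hBorel hM hMR hφ hR heA hee hpick hpickm (fun x => (hbest x).1)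
      (fun a o => hPm {p | p a = o}) hC hAW hFW hsepW hcode
  refine ⟨M', R', φ', hM', hR', hφ', hMR', hM'M, hR'M, hext, ?_⟩
  set dom := (M' ∪ R' ∪ R)ᶜ with hdom_def
  have hdom : (M ∪ R)ᶜ ⊆ dom := compl_subset_compl.2
    (union_subset_union_left R (union_subset hM'M hR'M))
  have hdomR : dom ⊆ Rᶜ := compl_subset_compl.2 subset_union_right
  -- recognition of `C` and of the code
  obtain ⟨T, hT⟩ := hrec.exists_agree hdom hext
  obtain ⟨T₁, hT₁⟩ := exists_agree_rank_le hfree hMR hdom hdomR hext hT hF hFb hA₁A hcoreW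
    (fun c hc c' hc' a ha a' ha' w hw w' hw' h =>
      hsepV c hc c' hc' _ (hV a ha w hw) _ (hV a' ha' w' hw') h)
    hval (fun x => (hbest x).2.1) (fun x => (hbest x).2.2.1) (fun x => (hbest x).2.2.2) hPφ hφW
  obtain ⟨T₂, hT₂⟩ := exists_agree_mem_of_greedy (q := q) (fun x => hN (P x)) hHinv hHS hSH
    hSanti hCsep hCcov hT₁
  let B : Finset G := (Finset.range n).biUnion fun k => F.image (fun f => f * e (k + 2))
  have hB : ∀ k < n, ∀ f ∈ F, f * e (k + 2) ∈ B := fun k hk f hf =>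
    Finset.mem_biUnion.2 ⟨k, Finset.mem_range.2 hk, Finset.mem_image_of_mem _ hf⟩
  obtain ⟨T₃, hT₃⟩ : ∃ T₃ : Finset G, ∀ x ∈ C, ∀ y, Agree dom φ' T₃ x y →
      y ∈ C ∧ ∀ k < n, code x k = code y k := by
    refine ⟨T₂ ∪ (B ∪ T * B), fun x hx y hxy => ?_⟩
    have hy : y ∈ C := hT₂ x hx y (hxy.mono Finset.subset_union_left)
    refine ⟨hy, fun k hk => ?_⟩
    rw [Bool.eq_iff_iff, (hbits k hk x hx).2, (hbits k hk y hy).2]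
    suffices h : (F.filter fun f => (f * e (k + 2)) • x ∈ Rᶜ ∩ φ' ⁻¹' {true}) =
        F.filter fun f => (f * e (k + 2)) • y ∈ Rᶜ ∩ φ' ⁻¹' {true} by rw [h]
    refine Finset.filter_congr fun f hf => ?_
    have h1 : (f * e (k + 2)) • x ∈ R ↔ (f * e (k + 2)) • y ∈ R :=
      hT _ _ (hxy.smul fun t ht => Finset.mem_union_right _ (Finset.mem_union_right _
        (Finset.mul_mem_mul ht (hB k hk f hf))))
    rcases (hbits k hk x hx).1 f hf with h2 | h2
    · simp [h2, h1.1 h2]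
    · have h3 : (f * e (k + 2)) • x ∉ R := hdomR h2
      have h4 : (f * e (k + 2)) • y ∉ R := fun h => h3 (h1.2 h)
      have h5 := ((hbits k hk y hy).1 f hf).resolve_left h4
      have h6 := hxy _ (Finset.mem_union_right _ (Finset.mem_union_left _ (hB k hk f hf))) h2 h5
      simp [h3, h4, h6]
  have hsynd : ∀ (k : ℕ) (Q : Set X),
      (∀ z, z ∈ Q ↔ ∃ c ∈ C, z = (pick (e k • c) * e k) • c) → Syndetic (G := G) Q := by
    intro k Q hQ
    refine ⟨(F * {e k} * S 0)⁻¹, fun x => ?_⟩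
    obtain ⟨g, hg, hgx⟩ := hCsynd x
    refine ⟨(pick (e k • g • x) * e k * g)⁻¹, Finset.inv_mem_inv (Finset.mul_mem_mul
      (Finset.mul_mem_mul (hpick _).1 (Finset.mem_singleton_self _)) hg), ?_⟩
    rw [inv_inv, hQ]
    exact ⟨g • x, hgx, by simp only [mul_smul]⟩
  refine ⟨hsynd 1 M' hmemM', hsynd 0 R' hmemR', ?_, ?_⟩
  · refine ⟨(F.biUnion fun f => T₃.image (· * (f * e 0)⁻¹)).image (·⁻¹), fun x hx y hy => ?_⟩
    by_contra hcon
    have hxy := agree_of_not_exists hcon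
    obtain ⟨c, hc, rfl⟩ := (hmemR' x).1 hx
    set f := pick (e 0 • c) with hf
    have hfF : f ∈ F := (hpick _).1
    have h1 : Agree dom φ' T₃ c ((f * e 0)⁻¹ • y) := by
      have := hxy.smul (T := T₃) (g := (f * e 0)⁻¹) fun t ht =>
        Finset.mem_biUnion.2 ⟨f, hfF, Finset.mem_image_of_mem _ ht⟩
      rwa [inv_smul_smul] at this
    obtain ⟨h2, h3⟩ := hT₃ c hc _ h1
    refine hy ((hmemR' y).2 ⟨_, h2, ?_⟩)
    rw [← (hcodeinj _ _ h3).1, ← hf, smul_inv_smul]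
  · refine ⟨((S 0).biUnion fun g => T₃.image (· * g)).image (·⁻¹), fun x => ?_⟩
    by_contra hcon
    have hxy := agree_of_not_exists hcon
    obtain ⟨g, hg, hgx⟩ := hCsynd x
    obtain ⟨-, h2⟩ := hT₃ _ hgx _ (hxy.smul (T := T₃) (g := g) fun t ht =>
      Finset.mem_biUnion.2 ⟨g, hg, Finset.mem_image_of_mem _ ht⟩)
    refine (hcodeinj _ _ h2).2 g hg ?_
    simp only [← mul_smul, inv_mul_cancel_right]
end
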